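/- arXiv:2204.01408 — 4 statements merged into one kernel-verified Lean document; each statement's English description precedes it below -/
import Mathlib

section
/- Let n ≥ 2, let μ be a Borel probability measure on the unit sphere S^{n−1} ⊂ ℝⁿ, let 1 < p < ∞ and β > 0 satisfy n − βp > 0, and suppose there is a constant C > 0 such that ‖K_δ‖_{μ,p} ≤ C δ^{−β} for all δ ∈ (0,1). Then for every Borel set Ω ⊆ S^{n−1} containing the support of μ, every Ω-Kakeya set X ⊂ ℝⁿ has Hausdorff dimension dimH X ≥ n − βp. -/
open MeasureTheory Metric Set
open scoped ENNReal NNReal RealInnerProductSpace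

noncomputable section

/-- Euclidean space `ℝⁿ`. -/
abbrev Eucl (n : ℕ) : Type := EuclideanSpace ℝ (Fin n)

/-- The unit sphere `S^{n-1}` in `ℝⁿ`. -/
def unitSphere (n : ℕ) : Set (Eucl n) := Metric.sphere (0 : Eucl n) 1

/-- The tube `T_{e,δ}(a)`: points `x` with `|⟪x-a,e⟫| ≤ 1/2` and
`|x - a - ⟪x-a,e⟫e| ≤ δ`. -/
def tube {n : ℕ} (e a : Eucl n) (δ : ℝ) : Set (Eucl n) :=
  {x | |⟪x - a, e⟫| ≤ 1 / 2 ∧ ‖x - a - ⟪x - a, e⟫ • e‖ ≤ δ}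

/-- The Kakeya maximal function at scale `δ`:
`K_δ f (e) = sup_a |T_{e,δ}(a)|⁻¹ ∫_{T_{e,δ}(a)} |f|`. -/
def kakeyaMaxFn {n : ℕ} (δ : ℝ) (f : Eucl n → ℝ) (e : Eucl n) : ℝ≥0∞ :=
  ⨆ a : Eucl n,
    (∫⁻ x in tube e a δ, ENNReal.ofReal |f x| ∂volume) / volume (tube e a δ)

/-- The `(μ,p)`-norm of the Kakeya maximal operator at scale `δ`:
the supremum of `(∫ (K_δ f)^p dμ)^{1/p}` over `‖f‖_{L^p} ≤ 1`. -/
def kakeyaNorm {n : ℕ} (μ : Measure (Eucl n)) (p δ : ℝ) : ℝ≥0∞ :=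
  ⨆ f ∈ {f : Eucl n → ℝ | eLpNorm f (ENNReal.ofReal p) volume ≤ 1},
    (∫⁻ e, kakeyaMaxFn δ f e ^ p ∂μ) ^ (1 / p)

/-- Surface measure `σ` on the unit sphere: the `(n-1)`-dimensional Hausdorff
measure restricted to the sphere. -/
def sphereMeasure (n : ℕ) : Measure (Eucl n) :=
  (μH[(n : ℝ) - 1]).restrict (unitSphere n)

/-- `[μ]_d ≤ 1`, i.e. `μ(B(e,r)) ≤ r^d` for all `e ∈ S^{n-1}` and `r > 0`. -/
def frostman {n : ℕ} (μ : Measure (Eucl n)) (d : ℝ) : Prop :=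
  ∀ e ∈ unitSphere n, ∀ r : ℝ, 0 < r → μ (Metric.ball e r) ≤ ENNReal.ofReal (r ^ d)

/-- `X` is an `Ω`-Kakeya set: for every direction `e ∈ Ω`, `X` contains a unit
segment with direction `e`. -/
def IsOmegaKakeya {n : ℕ} (Ω X : Set (Eucl n)) : Prop :=
  ∀ e ∈ Ω, ∃ a : Eucl n, (fun t : ℝ => a + t • e) '' Set.Icc (0 : ℝ) 1 ⊆ X

/-- The (topological) support of a measure on `ℝⁿ`. -/
def measSupport {n : ℕ} (μ : Measure (Eucl n)) : Set (Eucl n) :=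
  {x | ∀ r : ℝ, 0 < r → 0 < μ (Metric.ball x r)}



lemma tube_measurable {n : ℕ} (a : Eucl n) (δ : ℝ) :
    MeasurableSet {z : Eucl n × Eucl n | z.2 ∈ tube z.1 a δ} := by
  unfold tube
  apply MeasurableSet.inter
  · exact (isClosed_le (f := fun z : Eucl n × Eucl n => |⟪z.2 - a, z.1⟫|) (g := fun _ => 1/2)
      (by fun_prop) (by fun_prop)).measurableSet
  · exact (isClosed_le (f := fun z : Eucl n × Eucl n => ‖z.2 - a - ⟪z.2 - a, z.1⟫ • z.1‖)
      (g := fun _ => δ) (by fun_prop) (by fun_prop)).measurableSet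

lemma tube_measurableSet {n : ℕ} (e a : Eucl n) (δ : ℝ) : MeasurableSet (tube e a δ) :=
  measurable_prodMk_left (x := e) (tube_measurable a δ)

/-- The pushforward of the restricted Lebesgue measure on the infinite cylinder. -/
def cylMeasure {n : ℕ} (e : Eucl n) (δ : ℝ) : Measure ℝ :=
  (volume.restrict {x : Eucl n | ‖x - ⟪x, e⟫ • e‖ ≤ δ}).map (fun x => ⟪x, e⟫)

lemma cyl_closed {n : ℕ} (e : Eucl n) (δ : ℝ) :
    MeasurableSet {x : Eucl n | ‖x - ⟪x, e⟫ • e‖ ≤ δ} :=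
  (isClosed_le (by fun_prop) (by fun_prop)).measurableSet

lemma cylMeasure_apply {n : ℕ} (e : Eucl n) (δ : ℝ) (S : Set ℝ) (hS : MeasurableSet S) :
    cylMeasure e δ S = volume {x : Eucl n | ⟪x, e⟫ ∈ S ∧ ‖x - ⟪x, e⟫ • e‖ ≤ δ} := by
  have hm : Measurable (fun x : Eucl n => ⟪x, e⟫) := by fun_prop
  rw [cylMeasure, Measure.map_apply hm hS, Measure.restrict_apply (hm hS)]
  rfl

lemma cyl_volume_translate {n : ℕ} (e b : Eucl n) (δ : ℝ) (S : Set ℝ) :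
    volume {x : Eucl n | ⟪x - b, e⟫ ∈ S ∧ ‖x - b - ⟪x - b, e⟫ • e‖ ≤ δ} =
    volume {x : Eucl n | ⟪x, e⟫ ∈ S ∧ ‖x - ⟪x, e⟫ • e‖ ≤ δ} := by
  rw [← measure_preimage_add_right volume (-b)
    {x : Eucl n | ⟪x, e⟫ ∈ S ∧ ‖x - ⟪x, e⟫ • e‖ ≤ δ}]
  simp only [sub_eq_add_neg]
  rfl

lemma cylMeasure_smul {n : ℕ} (e : Eucl n) (he : ‖e‖ = 1) (δ : ℝ) :
    ∃ c : ℝ≥0, cylMeasure e δ = c • (volume : Measure ℝ) := by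
  have hee : ⟪e, e⟫ = 1 := by rw [real_inner_self_eq_norm_sq, he]; norm_num
  have : (cylMeasure e δ).IsAddLeftInvariant := by
    constructor
    intro g
    ext S hS
    have hm : Measurable (fun x : ℝ => g + x) := by fun_prop
    rw [Measure.map_apply hm hS, cylMeasure_apply _ _ _ (hm hS), cylMeasure_apply _ _ _ hS,
      ← cyl_volume_translate e (-(g • e)) δ S]
    congr 1
    ext x
    have h1 : ⟪x - -(g • e), e⟫ = g + ⟪x, e⟫ := by
      rw [sub_neg_eq_add, inner_add_left, real_inner_smul_left, hee]; ring
    have h2 : x - -(g • e) - (g + ⟪x, e⟫) • e = x - ⟪x, e⟫ • e := by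
      rw [add_smul]; abel
    simp only [mem_ofPred_eq, h1, h2, mem_preimage]
  have : IsFiniteMeasureOnCompacts (cylMeasure e δ) := by
    constructor
    intro K hK
    rw [cylMeasure_apply _ _ _ hK.measurableSet]
    obtain ⟨R, hR⟩ := hK.isBounded.exists_norm_le
    refine lt_of_le_of_lt (measure_mono (t := closedBall 0 (δ + R)) ?_) measure_closedBall_lt_top
    rintro x ⟨h1, h2⟩
    rw [mem_closedBall_zero_iff]
    calc ‖x‖ = ‖(x - ⟪x, e⟫ • e) + ⟪x, e⟫ • e‖ := by congr 1; abel
      _ ≤ ‖x - ⟪x, e⟫ • e‖ + ‖⟪x, e⟫ • e‖ := norm_add_le _ _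
      _ ≤ δ + R := by
        rw [norm_smul, he, mul_one]
        exact add_le_add h2 (hR _ h1)
  exact ⟨_, Measure.isAddLeftInvariant_eq_smul (cylMeasure e δ) volume⟩

lemma tube_volume_ne_top {n : ℕ} (e b : Eucl n) (he : ‖e‖ = 1) (δ : ℝ) :
    volume (tube e b δ) ≠ ⊤ := by
  refine (lt_of_le_of_lt (measure_mono (t := closedBall b (δ + 1/2)) ?_)
    measure_closedBall_lt_top).ne
  rintro x ⟨h1, h2⟩
  rw [mem_closedBall, dist_eq_norm]
  calc ‖x - b‖ = ‖(x - b - ⟪x - b, e⟫ • e) + ⟪x - b, e⟫ • e‖ := by congr 1; abel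
    _ ≤ ‖x - b - ⟪x - b, e⟫ • e‖ + ‖⟪x - b, e⟫ • e‖ := norm_add_le _ _
    _ ≤ δ + 1/2 := by
      rw [norm_smul, he, mul_one]
      exact add_le_add h2 h1

lemma tube_volume_ne_zero {n : ℕ} (e b : Eucl n) (he : ‖e‖ = 1) (δ : ℝ) (hδ : 0 < δ) :
    volume (tube e b δ) ≠ 0 := by
  set r := min (1/2) (δ/2) with hr
  have hr0 : 0 < r := by positivity
  refine (lt_of_lt_of_le (measure_ball_pos volume b hr0) (measure_mono ?_)).ne'
  intro x hx
  rw [mem_ball, dist_eq_norm] at hx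
  have h1 : |⟪x - b, e⟫| ≤ ‖x - b‖ := by
    simpa [he] using abs_real_inner_le_norm (x - b) e
  have h3 : r ≤ 1/2 := min_le_left _ _
  have h4 : r ≤ δ/2 := min_le_right _ _
  refine ⟨by linarith, ?_⟩
  refine (norm_sub_le _ _).trans ?_
  rw [norm_smul, he, mul_one, Real.norm_eq_abs]
  linarith

lemma tube_slice {n : ℕ} (e b : Eucl n) (he : ‖e‖ = 1) (δ : ℝ) (S : Set ℝ)
    (hS : MeasurableSet S) (hS' : S ⊆ Icc (-(1/2)) (1/2)) :
    volume {x : Eucl n | x ∈ tube e b δ ∧ ⟪x - b, e⟫ ∈ S} = volume S * volume (tube e b δ) := by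
  obtain ⟨c, hc⟩ := cylMeasure_smul e he δ
  have h1 : volume (tube e b δ) = c := by
    have : tube e b δ = {x : Eucl n | ⟪x - b, e⟫ ∈ Icc (-(1/2) : ℝ) (1/2) ∧
        ‖x - b - ⟪x - b, e⟫ • e‖ ≤ δ} := by
      ext x; simp only [tube, mem_ofPred_eq, mem_Icc, abs_le]
    rw [this, cyl_volume_translate, ← cylMeasure_apply _ _ _ measurableSet_Icc, hc,
      Measure.smul_apply, Real.volume_Icc]
    norm_num
  have h2 : {x : Eucl n | x ∈ tube e b δ ∧ ⟪x - b, e⟫ ∈ S} = {x : Eucl n | ⟪x - b, e⟫ ∈ S ∧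
        ‖x - b - ⟪x - b, e⟫ • e‖ ≤ δ} := by
    ext x
    simp only [tube, mem_ofPred_eq]
    constructor
    · rintro ⟨⟨_, h⟩, h'⟩; exact ⟨h', h⟩
    · rintro ⟨h', h⟩; exact ⟨⟨abs_le.2 (hS' h'), h⟩, h'⟩
  rw [h2, cyl_volume_translate, ← cylMeasure_apply _ _ _ hS, hc, h1, Measure.smul_apply,
    ENNReal.smul_def, smul_eq_mul, mul_comm]

/-- Measurable minorant of the Kakeya maximal function of an indicator. -/
def minor {n : ℕ} (δ : ℝ) (F : Set (Eucl n)) (e : Eucl n) : ℝ≥0∞ :=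
  ⨆ j : ℕ, volume (F ∩ tube e (TopologicalSpace.denseSeq (Eucl n) j) δ) /
    volume (tube e (TopologicalSpace.denseSeq (Eucl n) j) δ)

lemma minor_measurable {n : ℕ} (δ : ℝ) (F : Set (Eucl n)) (hF : MeasurableSet F) :
    Measurable (minor δ F) := by
  unfold minor
  refine Measurable.iSup fun j => Measurable.div ?_ ?_
  · exact measurable_measure_prodMk_left (ν := (volume : Measure (Eucl n)))
      (s := {z : Eucl n × Eucl n | z.2 ∈ F} ∩ {z : Eucl n × Eucl n | z.2 ∈ tube z.1 _ δ})
      ((measurable_snd hF).inter (tube_measurable _ δ))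
  · exact measurable_measure_prodMk_left (ν := (volume : Measure (Eucl n))) (tube_measurable _ δ)

lemma minor_lower {n : ℕ} (δ : ℝ) (hδ : 0 < δ) (x : ℕ → Eucl n) (J : Set ℕ) (e a : Eucl n)
    (he : ‖e‖ = 1) :
    volume {t : ℝ | t ∈ Icc (0:ℝ) 1 ∧ a + t • e ∈ ⋃ i ∈ J, closedBall (x i) δ} ≤
      minor δ (⋃ i ∈ J, closedBall (x i) (3 * δ)) e := by
  obtain ⟨j, hb⟩ := (TopologicalSpace.denseRange_denseSeq (Eucl n)).exists_dist_lt
    (a + (1/2 : ℝ) • e) hδ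
  unfold minor
  refine le_iSup_of_le j ?_
  set b := TopologicalSpace.denseSeq (Eucl n) j
  rw [ENNReal.le_div_iff_mul_le (Or.inl (tube_volume_ne_zero e b he δ hδ))
    (Or.inl (tube_volume_ne_top e b he δ))]
  set T := {t : ℝ | t ∈ Icc (0:ℝ) 1 ∧ a + t • e ∈ ⋃ i ∈ J, closedBall (x i) δ} with hT
  have hTm : MeasurableSet T := by
    refine measurableSet_Icc.inter ?_
    have : Measurable (fun t : ℝ => a + t • e) := by fun_prop
    exact this (MeasurableSet.biUnion J.to_countable fun i _ => measurableSet_closedBall)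
  set S := (fun s : ℝ => s + 1/2) ⁻¹' T with hSdef
  have hSm : MeasurableSet S := (measurable_id.add_const _) hTm
  have hvol : volume S = volume T := measure_preimage_add_right volume (1/2 : ℝ) T
  have hS' : S ⊆ Icc (-(1/2)) (1/2) := by
    intro s hs
    have h := hs.1
    constructor <;> linarith [h.1, h.2]
  rw [← hvol, ← tube_slice e b he δ S hSm hS']
  apply measure_mono
  rintro y ⟨hy, hyS⟩
  refine ⟨?_, hy⟩
  have h2 := hyS.2
  simp only [mem_iUnion, exists_prop] at h2 ⊢
  obtain ⟨i, hi, h⟩ := h2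
  refine ⟨i, hi, ?_⟩
  rw [mem_closedBall, dist_eq_norm] at h ⊢
  rw [dist_eq_norm] at hb
  have hy2 := hy.2
  calc ‖y - x i‖ = ‖(y - b - ⟪y - b, e⟫ • e) - (a + (1/2 : ℝ) • e - b) +
        (a + (⟪y - b, e⟫ + 1/2) • e - x i)‖ := by congr 1; rw [add_smul]; abel
    _ ≤ ‖y - b - ⟪y - b, e⟫ • e‖ + ‖a + (1/2 : ℝ) • e - b‖ +
        ‖a + (⟪y - b, e⟫ + 1/2) • e - x i‖ := (norm_add_le _ _).trans (by gcongr; exact norm_sub_le _ _)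
    _ ≤ 3 * δ := by linarith

lemma minor_lintegral {n : ℕ} (μ : Measure (Eucl n)) [IsProbabilityMeasure μ] (p δ : ℝ)
    (hp : 1 < p) (F : Set (Eucl n)) (hF : MeasurableSet F) (V : ℝ) (hV : 0 < V)
    (hFV : volume F ≤ ENNReal.ofReal V) :
    ∫⁻ e, minor δ F e ∂μ ≤ kakeyaNorm μ p δ * ENNReal.ofReal (V ^ (1 / p)) := by
  have hp0 : 0 < p := by linarith
  have hV1 : 0 < V ^ (1/p) := by positivity
  set c := (V ^ (1/p))⁻¹ with hc
  have hc0 : 0 < c := by positivity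
  set f : Eucl n → ℝ := F.indicator (fun _ => c) with hf
  have hf1 : eLpNorm f (ENNReal.ofReal p) volume ≤ 1 := by
    rw [hf]
    refine (eLpNorm_indicator_const_le _ _).trans ?_
    rw [ENNReal.toReal_ofReal hp0.le, Real.enorm_of_nonneg hc0.le]
    calc ENNReal.ofReal c * volume F ^ (1/p) ≤ ENNReal.ofReal c * ENNReal.ofReal V ^ (1/p) := by
          gcongr
      _ = 1 := by
        rw [ENNReal.ofReal_rpow_of_pos hV, ← ENNReal.ofReal_mul hc0.le, hc,
          inv_mul_cancel₀ hV1.ne', ENNReal.ofReal_one]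
  have hle : (∫⁻ e, kakeyaMaxFn δ f e ^ p ∂μ) ^ (1 / p) ≤ kakeyaNorm μ p δ := by
    unfold kakeyaNorm
    exact le_iSup₂_of_le f hf1 le_rfl
  have hpt : ∀ e, ENNReal.ofReal c * minor δ F e ≤ kakeyaMaxFn δ f e := by
    intro e
    unfold minor kakeyaMaxFn
    rw [ENNReal.mul_iSup]
    refine iSup_le fun j => le_iSup_of_le (TopologicalSpace.denseSeq (Eucl n) j) ?_
    rw [← mul_div_assoc]
    gcongr
    have : (fun x => ENNReal.ofReal |f x|) = F.indicator (fun _ => ENNReal.ofReal c) := by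
      ext x
      by_cases hx : x ∈ F <;> simp [hf, hx, abs_of_pos hc0]
    rw [this, lintegral_indicator_const hF, Measure.restrict_apply hF]
  have hJ : ∫⁻ e, minor δ F e ∂μ ≤ (∫⁻ e, minor δ F e ^ p ∂μ) ^ (1/p) := by
    have h := eLpNorm_le_eLpNorm_of_exponent_le (μ := μ) (f := minor δ F) (p := 1)
      (q := ENNReal.ofReal p) (by simpa using hp.le)
      (minor_measurable δ F hF).aestronglyMeasurable
    rw [eLpNorm_one_eq_lintegral_enorm, eLpNorm_eq_lintegral_rpow_enorm_toReal
      (by simpa using hp0) (by simp), ENNReal.toReal_ofReal hp0.le] at h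
    simpa using h
  have h3 : ENNReal.ofReal c * ∫⁻ e, minor δ F e ∂μ ≤ kakeyaNorm μ p δ := by
    refine le_trans ?_ hle
    calc _ ≤ ENNReal.ofReal c * (∫⁻ e, minor δ F e ^ p ∂μ) ^ (1/p) := by gcongr
      _ = (∫⁻ e, (ENNReal.ofReal c * minor δ F e) ^ p ∂μ) ^ (1/p) := by
        simp_rw [ENNReal.mul_rpow_of_nonneg _ _ hp0.le]
        rw [lintegral_const_mul _ ((minor_measurable δ F hF).pow_const _),
          ENNReal.mul_rpow_of_nonneg _ _ (by positivity), ← ENNReal.rpow_mul,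
          mul_one_div_cancel hp0.ne', ENNReal.rpow_one]
      _ ≤ _ := by
        gcongr with e
        exact hpt e
  calc ∫⁻ e, minor δ F e ∂μ = (ENNReal.ofReal c * ∫⁻ e, minor δ F e ∂μ) *
        ENNReal.ofReal (V ^ (1 / p)) := by
        rw [mul_comm (ENNReal.ofReal c), mul_assoc, ← ENNReal.ofReal_mul hc0.le, hc,
          inv_mul_cancel₀ hV1.ne', ENNReal.ofReal_one, mul_one]
    _ ≤ _ := by gcongr

lemma exists_cover {n : ℕ} (X : Set (Eucl n)) (d : ℝ≥0) (hd : μH[d] X = 0) (r : ℝ≥0∞)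
    (hr : 0 < r) : ∃ t : ℕ → Set (Eucl n), X ⊆ ⋃ i, t i ∧ (∀ i, ediam (t i) ≤ r) ∧
      ∑' i, (⨆ _ : (t i).Nonempty, ediam (t i) ^ (d : ℝ)) ≤ 1 := by
  rw [Measure.hausdorffMeasure_apply] at hd
  have h := (le_iSup₂ (f := fun (r : ℝ≥0∞) (_ : 0 < r) =>
        ⨅ (t : ℕ → Set (Eucl n)) (_ : X ⊆ ⋃ n, t n) (_ : ∀ n, ediam (t n) ≤ r),
          ∑' n, ⨆ _ : (t n).Nonempty, ediam (t n) ^ (d : ℝ)) r hr).trans hd.le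
  have h1 := lt_of_le_of_lt h (zero_lt_one)
  simp only [iInf_lt_iff] at h1
  obtain ⟨t, h1, h2, h3⟩ := h1
  exact ⟨t, h1, h2, h3.le⟩

/-- volume of a union of balls at scale `δ`. -/
lemma volume_balls {n : ℕ} (t : ℕ → Set (Eucl n)) (x : ℕ → Eucl n) (d δ : ℝ) (hd : 0 < d)
    (hδ : 0 < δ) (J : Set ℕ)
    (hJ : ∀ i ∈ J, (t i).Nonempty ∧ ENNReal.ofReal (δ / 2) ≤ ediam (t i))
    (hsum : ∑' i, (⨆ _ : (t i).Nonempty, ediam (t i) ^ d) ≤ 1) :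
    volume (⋃ i ∈ J, closedBall (x i) (3 * δ)) ≤
      ENNReal.ofReal ((3 ^ n * 2 ^ d * (volume (ball (0 : Eucl n) 1)).toReal) * δ ^ (n - d)) := by
  have hb : volume (ball (0 : Eucl n) 1) ≠ ⊤ := measure_ball_lt_top.ne
  set v := (volume (ball (0 : Eucl n) 1)).toReal with hv
  have hv0 : 0 ≤ v := ENNReal.toReal_nonneg
  set A := (3 ^ n * 2 ^ d * v) * δ ^ (n - d) with hA
  have hA0 : 0 ≤ A := by positivity
  have key : ∀ i ∈ J, volume (closedBall (x i) (3 * δ)) ≤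
      ENNReal.ofReal A * (⨆ _ : (t i).Nonempty, ediam (t i) ^ d) := by
    intro i hi
    obtain ⟨h1, h2⟩ := hJ i hi
    rw [ciSup_pos h1, Measure.addHaar_closedBall volume (x i) (by positivity : 0 ≤ 3 * δ)]
    calc ENNReal.ofReal ((3 * δ) ^ Module.finrank ℝ (Eucl n)) * volume (ball (0 : Eucl n) 1)
        = ENNReal.ofReal (A * (δ / 2) ^ d) := by
          rw [← ENNReal.ofReal_toReal hb, ← hv, ← ENNReal.ofReal_mul (by positivity)]
          congr 1
          rw [finrank_euclideanSpace_fin, hA, Real.div_rpow hδ.le (by norm_num),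
            Real.rpow_sub hδ, Real.rpow_natCast, mul_pow]
          field_simp
      _ = ENNReal.ofReal A * ENNReal.ofReal (δ / 2) ^ d := by
          rw [ENNReal.ofReal_mul hA0, ENNReal.ofReal_rpow_of_pos (by positivity)]
      _ ≤ _ := by gcongr
  calc volume (⋃ i ∈ J, closedBall (x i) (3 * δ))
      = volume (⋃ i, ⋃ (_ : i ∈ J), closedBall (x i) (3 * δ)) := rfl
    _ ≤ ∑' i, volume (⋃ (_ : i ∈ J), closedBall (x i) (3 * δ)) := measure_iUnion_le _
    _ ≤ ∑' i, ENNReal.ofReal A * (⨆ _ : (t i).Nonempty, ediam (t i) ^ d) := by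
        refine ENNReal.tsum_le_tsum fun i => ?_
        by_cases hi : i ∈ J
        · simpa [hi] using key i hi
        · simp [hi]
    _ = ENNReal.ofReal A * ∑' i, (⨆ _ : (t i).Nonempty, ediam (t i) ^ d) := ENNReal.tsum_mul_left
    _ ≤ ENNReal.ofReal A * 1 := by gcongr
    _ = _ := mul_one _

lemma exists_scale (D : ℝ) (k : ℕ) (hD : 0 < D) (hDk : D ≤ (1/2 : ℝ) ^ k) :
    ∃ m : ℕ, (1/2 : ℝ) ^ (k + m) / 2 ≤ D ∧ D ≤ (1/2 : ℝ) ^ (k + m) := by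
  obtain ⟨m, h1, h2⟩ := exists_nat_pow_near_of_lt_one (x := D / (1/2) ^ k) (y := (1/2 : ℝ))
    (by positivity) ((div_le_one (by positivity)).2 hDk) (by norm_num) (by norm_num)
  rw [lt_div_iff₀ (by positivity)] at h1
  rw [div_le_iff₀ (by positivity)] at h2
  refine ⟨m, ?_, ?_⟩
  · rw [pow_succ] at h1; rw [pow_add]; linarith
  · rw [pow_add]; linarith

lemma main_bound {n : ℕ} (μ : Measure (Eucl n)) [IsProbabilityMeasure μ]
    (p β : ℝ) (hp : 1 < p) (C : ℝ) (hC : 0 < C)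
    (hK : ∀ δ ∈ Set.Ioo (0 : ℝ) 1, kakeyaNorm μ p δ ≤ ENNReal.ofReal (C * δ ^ (-β)))
    (Ω : Set (Eucl n)) (hΩ : Ω ⊆ unitSphere n) (hΩμ : ∀ᵐ e ∂μ, e ∈ Ω)
    (X : Set (Eucl n)) (hX : IsOmegaKakeya Ω X) (d : ℝ≥0) (hd : 0 < d) (hdX : μH[d] X = 0)
    (k : ℕ) (hk : 1 ≤ k) :
    (1 : ℝ≥0∞) ≤ ∑' m : ℕ, ENNReal.ofReal (C * ((1/2 : ℝ) ^ (k + m)) ^ (-β)) *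
      ENNReal.ofReal (((3 ^ n * 2 ^ (d : ℝ) * (volume (ball (0 : Eucl n) 1)).toReal) *
        ((1/2 : ℝ) ^ (k + m)) ^ (n - (d : ℝ))) ^ (1 / p)) := by
  obtain ⟨t, ht1, ht2, ht3⟩ := exists_cover X d hdX (ENNReal.ofReal ((1/2 : ℝ) ^ k))
    (by rw [ENNReal.ofReal_pos]; positivity)
  have hx : ∀ i, ∃ x : Eucl n, (t i).Nonempty → x ∈ t i := by
    intro i
    by_cases h : (t i).Nonempty
    · exact ⟨h.some, fun _ => h.some_mem⟩
    · exact ⟨0, fun h' => absurd h' h⟩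
  choose x hx using hx
  have hfin : ∀ i, ediam (t i) ≠ ⊤ := fun i => ne_top_of_le_ne_top ENNReal.ofReal_ne_top (ht2 i)
  let δ : ℕ → ℝ := fun m => (1/2 : ℝ) ^ (k + m)
  have hδ0 : ∀ m, 0 < δ m := fun m => by positivity
  have hδ1 : ∀ m, δ m < 1 := fun m => pow_lt_one₀ (by norm_num) (by norm_num) (by omega)
  let J : ℕ → Set ℕ := fun m => {i | (t i).Nonempty ∧ ENNReal.ofReal (δ m / 2) ≤ ediam (t i) ∧
    ediam (t i) ≤ ENNReal.ofReal (δ m)}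
  let F : ℕ → Set (Eucl n) := fun m => ⋃ i ∈ J m, closedBall (x i) (3 * δ m)
  have hF : ∀ m, MeasurableSet (F m) := fun m =>
    MeasurableSet.biUnion (J m).to_countable fun i _ => measurableSet_closedBall
  have hv0 : 0 < (volume (ball (0 : Eucl n) 1)).toReal :=
    ENNReal.toReal_pos (measure_ball_pos _ _ one_pos).ne' measure_ball_lt_top.ne
  have hbnd : ∀ m, ∫⁻ e, minor (δ m) (F m) e ∂μ ≤
      ENNReal.ofReal (C * (δ m) ^ (-β)) *
      ENNReal.ofReal (((3 ^ n * 2 ^ (d : ℝ) * (volume (ball (0 : Eucl n) 1)).toReal) *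
        (δ m) ^ (n - (d : ℝ))) ^ (1 / p)) := by
    intro m
    have hδm := hδ0 m
    refine (minor_lintegral μ p (δ m) hp (F m) (hF m)
      ((3 ^ n * 2 ^ (d : ℝ) * (volume (ball (0 : Eucl n) 1)).toReal) *
        (δ m) ^ (n - (d : ℝ))) (by positivity)
      (volume_balls t x d (δ m) (by exact_mod_cast hd) (hδ0 m) (J m)
        (fun i hi => ⟨hi.1, hi.2.1⟩) ht3)).trans ?_
    gcongr
    exact hK _ ⟨hδ0 m, hδ1 m⟩
  have hpt : ∀ e ∈ Ω, (1 : ℝ≥0∞) ≤ ∑' m, minor (δ m) (F m) e := by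
    intro e he
    have he1 : ‖e‖ = 1 := by simpa [unitSphere] using hΩ he
    obtain ⟨a, ha⟩ := hX e he
    let N : ℕ → Set ℝ := fun i => {s : ℝ | a + s • e ∈ t i ∧ ediam (t i) = 0}
    have hN : ∀ i, volume (N i) = 0 := by
      intro i
      apply Set.Subsingleton.measure_zero
      rintro s ⟨hs, h0⟩ s' ⟨hs', _⟩
      have h := Metric.ediam_eq_zero_iff.1 h0 hs hs'
      have he0 : e ≠ 0 := by rintro rfl; simp at he1
      exact smul_left_injective ℝ he0 (add_left_cancel h)
    have hcov : Icc (0:ℝ) 1 ⊆ (⋃ i, N i) ∪ ⋃ m,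
        {s : ℝ | s ∈ Icc (0:ℝ) 1 ∧ a + s • e ∈ ⋃ i ∈ J m, closedBall (x i) (δ m)} := by
      intro s hs
      obtain ⟨i, hi⟩ := mem_iUnion.1 (ht1 (ha ⟨s, hs, rfl⟩))
      by_cases h0 : ediam (t i) = 0
      · exact Or.inl (mem_iUnion.2 ⟨i, hi, h0⟩)
      · right
        have hD0 : 0 < (ediam (t i)).toReal := ENNReal.toReal_pos h0 (hfin i)
        obtain ⟨m, h1, h2⟩ := exists_scale (ediam (t i)).toReal k hD0
          (ENNReal.toReal_le_of_le_ofReal (by positivity) (ht2 i))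
        have h1' : ENNReal.ofReal (δ m / 2) ≤ ediam (t i) := ENNReal.ofReal_le_of_le_toReal h1
        have h2' : ediam (t i) ≤ ENNReal.ofReal (δ m) := by
          rw [← ENNReal.ofReal_toReal (hfin i)]
          exact ENNReal.ofReal_le_ofReal h2
        have hne : (t i).Nonempty := ⟨_, hi⟩
        refine mem_iUnion.2 ⟨m, hs, mem_iUnion₂.2 ⟨i, ⟨hne, h1', h2'⟩, ?_⟩⟩
        rw [mem_closedBall, dist_edist]
        exact ENNReal.toReal_le_of_le_ofReal (hδ0 m).le
          ((Metric.edist_le_ediam_of_mem hi (hx i hne)).trans h2')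
    calc (1 : ℝ≥0∞) = volume (Icc (0:ℝ) 1) := by simp
      _ ≤ volume (⋃ i, N i) + volume (⋃ m,
        {s : ℝ | s ∈ Icc (0:ℝ) 1 ∧ a + s • e ∈ ⋃ i ∈ J m, closedBall (x i) (δ m)}) :=
          (measure_mono hcov).trans (measure_union_le _ _)
      _ = volume (⋃ m,
        {s : ℝ | s ∈ Icc (0:ℝ) 1 ∧ a + s • e ∈ ⋃ i ∈ J m, closedBall (x i) (δ m)}) := by
          rw [measure_iUnion_null hN, zero_add]
      _ ≤ ∑' m, volume
        {s : ℝ | s ∈ Icc (0:ℝ) 1 ∧ a + s • e ∈ ⋃ i ∈ J m, closedBall (x i) (δ m)} :=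
          measure_iUnion_le _
      _ ≤ _ := ENNReal.tsum_le_tsum fun m => minor_lower (δ m) (hδ0 m) x (J m) e a he1
  calc (1 : ℝ≥0∞) = ∫⁻ _, 1 ∂μ := by simp
    _ ≤ ∫⁻ e, ∑' m, minor (δ m) (F m) e ∂μ := lintegral_mono_ae (hΩμ.mono hpt)
    _ = ∑' m, ∫⁻ e, minor (δ m) (F m) e ∂μ :=
        lintegral_tsum fun m => (minor_measurable _ _ (hF m)).aemeasurable
    _ ≤ _ := ENNReal.tsum_le_tsum hbnd

/-- If `μ` is a Borel probability measure on `S^{n-1}`, `1 < p < ∞`, `β > 0` with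
`n - βp > 0`, and `‖K_δ‖_{μ,p} ≤ C δ^{-β}` for all `δ ∈ (0,1)`, then for every Borel
set `Ω ⊆ S^{n-1}` containing the support of `μ`, every `Ω`-Kakeya set `X` satisfies
`dimH X ≥ n - βp`. -/
theorem stmt0 (n : ℕ) (hn : 2 ≤ n)
    (μ : Measure (Eucl n)) [IsProbabilityMeasure μ] (hμS : μ (unitSphere n)ᶜ = 0)
    (p β : ℝ) (hp : 1 < p) (hβ : 0 < β) (hnβp : 0 < (n : ℝ) - β * p)
    (C : ℝ) (hC : 0 < C)
    (hK : ∀ δ ∈ Set.Ioo (0 : ℝ) 1, kakeyaNorm μ p δ ≤ ENNReal.ofReal (C * δ ^ (-β)))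
    (Ω : Set (Eucl n)) (hΩmeas : MeasurableSet Ω) (hΩ : Ω ⊆ unitSphere n)
    (hsupp : measSupport μ ⊆ Ω)
    (X : Set (Eucl n)) (hX : IsOmegaKakeya Ω X) :
    ENNReal.ofReal ((n : ℝ) - β * p) ≤ dimH X := by
  by_contra hlt
  rw [not_le] at hlt
  obtain ⟨d, hd1, hd2⟩ := ENNReal.lt_iff_exists_nnreal_btwn.1 hlt
  have hd0 : 0 < d := by exact_mod_cast (zero_le.trans_lt hd1 : (0 : ℝ≥0∞) < d)
  have hd3 : (d : ℝ) < n - β * p := by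
    rw [← ENNReal.ofReal_coe_nnreal] at hd2
    exact (ENNReal.ofReal_lt_ofReal_iff hnβp).1 hd2
  have hΩμ : ∀ᵐ e ∂μ, e ∈ Ω := by
    filter_upwards [Measure.support_mem_ae (μ := μ)] with e he
    exact hsupp (fun r hr => (Measure.mem_support_iff_forall e).1 he _ (ball_mem_nhds e hr))
  have hp0 : 0 < p := by linarith
  set A := 3 ^ n * 2 ^ (d : ℝ) * (volume (ball (0 : Eucl n) 1)).toReal with hA
  have hA0 : 0 ≤ A := by positivity
  set η := (n - β * p - d) / p with hη
  have hη0 : 0 < η := div_pos (by linarith) hp0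
  set q := (1/2 : ℝ) ^ η with hq
  have hq0 : 0 < q := by positivity
  have hq1 : q < 1 := Real.rpow_lt_one (by norm_num) (by norm_num) hη0
  set B := C * A ^ (1 / p) with hB
  have hB0 : 0 ≤ B := by positivity
  have hterm : ∀ k : ℕ, ENNReal.ofReal (C * ((1/2 : ℝ) ^ k) ^ (-β)) *
      ENNReal.ofReal ((A * ((1/2 : ℝ) ^ k) ^ (n - (d : ℝ))) ^ (1 / p)) =
      ENNReal.ofReal (B * q ^ k) := by
    intro k
    have hz : 0 < (1/2 : ℝ) ^ k := by positivity
    rw [← ENNReal.ofReal_mul (by positivity)]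
    congr 1
    have h1 : q ^ k = ((1/2 : ℝ) ^ k) ^ (-β) * (((1/2 : ℝ) ^ k) ^ (n - (d : ℝ))) ^ (1 / p) := by
      rw [← Real.rpow_mul hz.le, ← Real.rpow_add hz, hq, ← Real.rpow_mul_natCast (by norm_num),
        ← Real.rpow_natCast_mul (by norm_num)]
      congr 1
      rw [hη]
      field_simp
      ring
    rw [Real.mul_rpow hA0 (by positivity), h1, hB]
    ring
  have hbound : ∀ k : ℕ, 1 ≤ k → 1 ≤ B * (1 - q)⁻¹ * q ^ k := by
    intro k hk
    have h := main_bound μ p β hp C hC hK Ω hΩ hΩμ X hX d hd0 (hausdorffMeasure_of_dimH_lt hd1) k hk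
    rw [← hA] at h
    simp_rw [hterm] at h
    have hs : HasSum (fun m : ℕ => B * q ^ (k + m)) (B * (1 - q)⁻¹ * q ^ k) := by
      have := (hasSum_geometric_of_lt_one hq0.le hq1).mul_left (B * q ^ k)
      convert! this using 1
      · ext m; rw [pow_add]; ring
      · ring
    rw [← ENNReal.ofReal_tsum_of_nonneg (fun m => by positivity) hs.summable, hs.tsum_eq] at h
    exact ENNReal.one_le_ofReal.1 h
  have hlim : Filter.Tendsto (fun k : ℕ => B * (1 - q)⁻¹ * q ^ k) Filter.atTop (nhds 0) := by
    simpa using (tendsto_pow_atTop_nhds_zero_of_lt_one hq0.le hq1).const_mul (B * (1 - q)⁻¹)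
  obtain ⟨k, hk1, hk2⟩ := ((hlim.eventually (gt_mem_nhds zero_lt_one)).and
    (Filter.eventually_ge_atTop 1)).exists
  exact absurd (hbound k hk2) (not_le.2 hk1)

end
end

section
/- Let n ≥ 2, 1 < p < ∞, 0 ≤ d ≤ n−1, and let μ be a Borel probability measure on S^{n−1} with [μ]_d ≤ 1. Then there is a constant C(n,d,p) such that for every δ ∈ (0,1), ‖K_δ‖_{μ,p} ≤ C(n,d,p) δ^{−(n−(d+1))/p} ‖K_δ‖_{σ,p}. -/
open MeasureTheory Metric Set
open scoped ENNReal NNReal RealInnerProductSpace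

noncomputable section

lemma exists_unit_cover (n : ℕ) : ∃ t : Finset (Eucl n),
    ∀ w : Eucl n, ‖w‖ ≤ 3 / 2 → ∃ c ∈ t, ‖w - c‖ ≤ 1 := by
  obtain ⟨t, -, htf, hc⟩ := (isCompact_closedBall (0 : Eucl n) (3 / 2)).finite_cover_balls
    (e := 1) one_pos
  refine ⟨htf.toFinset, fun w hw => ?_⟩
  have := hc (mem_closedBall_zero_iff.2 hw)
  simp only [mem_iUnion, exists_prop] at this
  obtain ⟨c, h1, h2⟩ := this
  exact ⟨c, by simpa using h1, by rw [← dist_eq_norm]; exact h2.le⟩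

lemma norm_perp_le {n : ℕ} (e v : Eucl n) (he : ‖e‖ = 1) (t : ℝ) :
    ‖v - ⟪v, e⟫ • e‖ ≤ ‖v - t • e‖ := by
  have hee : ⟪e, e⟫ = 1 := by rw [real_inner_self_eq_norm_sq, he]; norm_num
  have h : v - t • e = (v - ⟪v, e⟫ • e) + (⟪v, e⟫ - t) • e := by module
  have ho : ⟪v - ⟪v, e⟫ • e, (⟪v, e⟫ - t) • e⟫ = 0 := by
    rw [inner_smul_right, inner_sub_left, inner_smul_left, hee]; simp
  have := norm_add_sq_eq_norm_sq_add_norm_sq_of_inner_eq_zero _ _ ho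
  rw [← h] at this
  nlinarith [norm_nonneg (v - t • e), norm_nonneg (v - ⟪v, e⟫ • e),
    mul_self_nonneg ‖(⟪v, e⟫ - t) • e‖]

lemma tube_cover {n : ℕ} (t : Finset (Eucl n))
    (ht : ∀ w : Eucl n, ‖w‖ ≤ 3 / 2 → ∃ c ∈ t, ‖w - c‖ ≤ 1)
    (e e' a : Eucl n) (he : ‖e‖ = 1) (he' : ‖e'‖ = 1) (δ : ℝ) (h0 : 0 < δ) (h1 : δ < 1)
    (hd : ‖e - e'‖ ≤ δ) :
    tube e a δ ⊆ ⋃ q : t × Fin 3,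
      tube e' (a + ((q.2 : ℕ) - 1 : ℝ) • e' +
        δ • ((q.1 : Eucl n) - ⟪(q.1 : Eucl n), e'⟫ • e')) δ := by
  intro x hx
  obtain ⟨hx1, hx2⟩ := hx
  set y := x - a with hy
  have hee : ⟪e', e'⟫ = 1 := by rw [real_inner_self_eq_norm_sq, he']; norm_num
  set w := y - ⟪y, e'⟫ • e' with hw
  have hw1 : ‖w‖ ≤ 3 / 2 * δ := by
    calc ‖w‖ ≤ ‖y - ⟪y, e⟫ • e'‖ := norm_perp_le e' y he' _
      _ = ‖(y - ⟪y, e⟫ • e) + ⟪y, e⟫ • (e - e')‖ := by congr 1; module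
      _ ≤ ‖y - ⟪y, e⟫ • e‖ + ‖⟪y, e⟫ • (e - e')‖ := norm_add_le _ _
      _ ≤ δ + 1 / 2 * δ := by
        rw [norm_smul, Real.norm_eq_abs]; gcongr
      _ = _ := by ring
  have hy1 : ‖y‖ ≤ 3 / 2 := by
    calc ‖y‖ = ‖(y - ⟪y, e⟫ • e) + ⟪y, e⟫ • e‖ := by congr 1; module
      _ ≤ ‖y - ⟪y, e⟫ • e‖ + ‖⟪y, e⟫ • e‖ := norm_add_le _ _
      _ ≤ 1 + 1 / 2 := by
        rw [norm_smul, Real.norm_eq_abs, he, mul_one]; gcongr; linarith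
      _ = _ := by norm_num
  have hs : |⟪y, e'⟫| ≤ 3 / 2 := by
    have := abs_real_inner_le_norm y e'
    rw [he', mul_one] at this; linarith
  obtain ⟨c, hc, hcw⟩ := ht (δ⁻¹ • w) (by
    rw [norm_smul, Real.norm_eq_abs, abs_of_pos (inv_pos.2 h0), inv_mul_le_iff₀ h0]; linarith)
  have hk : ∃ k : Fin 3, |⟪y, e'⟫ - (((k : ℕ) : ℝ) - 1)| ≤ 1 / 2 := by
    rw [abs_le] at hs
    rcases le_total ⟪y, e'⟫ (-1 / 2) with h | h
    · exact ⟨0, by rw [abs_le]; constructor <;> norm_num <;> linarith⟩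
    rcases le_total ⟪y, e'⟫ (1 / 2) with h' | h'
    · exact ⟨1, by rw [abs_le]; constructor <;> norm_num <;> linarith⟩
    · exact ⟨2, by rw [abs_le]; constructor <;> norm_num <;> linarith⟩
  obtain ⟨k, hk⟩ := hk
  refine mem_iUnion.2 ⟨(⟨c, hc⟩, k), ?_⟩
  have hin : ⟪x - (a + (((k : ℕ) : ℝ) - 1) • e' + δ • (c - ⟪c, e'⟫ • e')), e'⟫
      = ⟪y, e'⟫ - (((k : ℕ) : ℝ) - 1) := by
    have : x - (a + (((k : ℕ) : ℝ) - 1) • e' + δ • (c - ⟪c, e'⟫ • e'))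
      = y - (((k : ℕ) : ℝ) - 1) • e' - δ • (c - ⟪c, e'⟫ • e') := by rw [hy]; module
    rw [this]
    simp only [inner_sub_left, inner_smul_left, hee]; simp
  constructor
  · simpa only [hin] using hk
  · simp only [hin]
    have hwe : ⟪w, e'⟫ = 0 := by
      rw [hw, inner_sub_left, inner_smul_left, hee]; simp
    have e1 : x - (a + (((k : ℕ) : ℝ) - 1) • e' + δ • (c - ⟪c, e'⟫ • e'))
        - (⟪y, e'⟫ - (((k : ℕ) : ℝ) - 1)) • e'
        = (w - δ • c) - ⟪w - δ • c, e'⟫ • e' := by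
      have e2 : ⟪w - δ • c, e'⟫ = - (δ * ⟪c, e'⟫) := by
        rw [inner_sub_left, hwe, inner_smul_left]; simp
      rw [e2, hw, ← sub_sub, ← sub_sub, ← hy]
      module
    rw [e1]
    calc _ ≤ ‖(w - δ • c) - (0 : ℝ) • e'‖ := norm_perp_le e' _ he' _
      _ = ‖δ • (δ⁻¹ • w - c)‖ := by
        congr 1; rw [smul_sub, smul_inv_smul₀ h0.ne']; simp
      _ ≤ δ := by
        rw [norm_smul, Real.norm_eq_abs, abs_of_pos h0]
        nlinarith

lemma tube_volume {n : ℕ} (e e' a b : Eucl n) (he : ‖e‖ = 1) (he' : ‖e'‖ = 1) (δ : ℝ) :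
    volume (tube e a δ) = volume (tube e' b δ) := by
  have key : ∀ (e a : Eucl n), volume (tube e a δ) = volume (tube e 0 δ) := by
    intro e a
    have : tube e a δ = (fun x => x + (-a)) ⁻¹' tube e 0 δ := by
      ext x; simp [tube, sub_eq_add_neg]
    rw [this, measure_preimage_add_right]
  rw [key e, key e']
  set R := (ℝ ∙ (e - e'))ᗮ.reflection with hR
  have hRe : R e = e' := Submodule.reflection_sub (by rw [he, he'])
  have : tube e 0 δ = R ⁻¹' tube e' 0 δ := by
    ext x
    have h2 : ⟪R x, e'⟫ = ⟪x, e⟫ := by rw [← hRe, LinearIsometryEquiv.inner_map_map]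
    simp only [tube, mem_ofPred_eq, mem_preimage, sub_zero, h2]
    rw [← hRe, ← map_smul, ← map_sub, LinearIsometryEquiv.norm_map]
  rw [this]
  exact R.measurePreserving.measure_preimage_emb
    R.toHomeomorph.measurableEmbedding _

lemma kakeya_compare (n : ℕ) : ∃ N : ℕ, 0 < N ∧ ∀ (f : Eucl n → ℝ) (e e' : Eucl n),
    ‖e‖ = 1 → ‖e'‖ = 1 → ∀ δ : ℝ, 0 < δ → δ < 1 → ‖e - e'‖ ≤ δ →
    kakeyaMaxFn δ f e ≤ N * kakeyaMaxFn δ f e' := by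
  obtain ⟨t, ht⟩ := exists_unit_cover n
  refine ⟨Fintype.card (t × Fin 3) + 1, by omega, ?_⟩
  intro f e e' he he' δ h0 h1 hd
  refine iSup_le fun a => ?_
  have hsub := tube_cover t ht e e' a he he' δ h0 h1 hd
  set b : t × Fin 3 → Eucl n := fun q => a + ((q.2 : ℕ) - 1 : ℝ) • e' +
        δ • ((q.1 : Eucl n) - ⟪(q.1 : Eucl n), e'⟫ • e')
  calc _ ≤ (∑ q, ∫⁻ x in tube e' (b q) δ, ENNReal.ofReal |f x|) / volume (tube e a δ) := by
        gcongr
        refine (lintegral_mono_set hsub).trans ?_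
        refine (lintegral_iUnion_le _ _).trans ?_
        rw [tsum_fintype]
    _ = ∑ q, (∫⁻ x in tube e' (b q) δ, ENNReal.ofReal |f x|) / volume (tube e' (b q) δ) := by
        rw [div_eq_mul_inv, Finset.sum_mul]
        refine Finset.sum_congr rfl fun q _ => ?_
        rw [div_eq_mul_inv, tube_volume e e' a (b q) he he']
    _ ≤ ∑ q : t × Fin 3, kakeyaMaxFn δ f e' := by
        refine Finset.sum_le_sum fun q _ => ?_
        exact le_iSup (fun a => (∫⁻ x in tube e' a δ, ENNReal.ofReal |f x|) /
          volume (tube e' a δ)) (b q)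
    _ ≤ _ := by
        rw [Finset.sum_const, nsmul_eq_mul]
        gcongr
        simp

lemma sphere_lower (m : ℕ) (hm : 1 ≤ m) : ∃ c : ℝ≥0∞, c ≠ 0 ∧ c ≠ ∞ ∧
    ∀ e ∈ unitSphere (m + 1), ∀ r : ℝ, 0 < r → r < 1 →
      c * ENNReal.ofReal (r ^ m) ≤ sphereMeasure (m + 1) (ball e r) := by
  have hH : (μH[(m : ℝ)] : Measure (Eucl m)).IsAddHaarMeasure := by
    have := isAddHaarMeasure_hausdorffMeasure (E := Eucl m)
    rwa [finrank_euclideanSpace_fin] at this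
  refine ⟨μH[(m : ℝ)] (ball (0 : Eucl m) (1 / 2)), (measure_ball_pos _ _ (by norm_num)).ne',
    measure_ball_lt_top.ne, ?_⟩
  intro e he r hr0 hr1
  have he1 : ‖e‖ = 1 := mem_sphere_zero_iff_norm.1 he
  have hene : e ≠ 0 := by intro h; simp [h] at he1
  have : Fact (Module.finrank ℝ (Eucl (m + 1)) = m + 1) := ⟨finrank_euclideanSpace_fin⟩
  let U := (OrthonormalBasis.fromOrthogonalSpanSingleton (𝕜 := ℝ) m hene).repr
  let Q : Eucl (m + 1) → Eucl m := fun x => U ((ℝ ∙ e)ᗮ.orthogonalProjectionOnto x)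
  have hQ : LipschitzWith 1 Q := by
    have h1 := (ℝ ∙ e)ᗮ.lipschitzWith_orthogonalProjectionOnto
    have h2 := U.lipschitz.comp h1
    rw [one_mul] at h2
    exact h2
  have hball : ball (0 : Eucl m) (r * (1 / 2)) ⊆ Q '' (ball e r ∩ unitSphere (m + 1)) := by
    intro y hy
    rw [mem_ball_zero_iff] at hy
    have hy0 := norm_nonneg y
    set z := U.symm y with hz
    have hzn : ‖(z : Eucl (m + 1))‖ = ‖y‖ := by
      exact U.symm.norm_map y
    have hze : ⟪(z : Eucl (m + 1)), e⟫ = 0 :=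
      Submodule.mem_orthogonal_singleton_iff_inner_left.1 z.2
    have hpos : 0 ≤ 1 - ‖y‖ ^ 2 := by nlinarith
    set s := Real.sqrt (1 - ‖y‖ ^ 2) with hs
    have hs2 : s ^ 2 = 1 - ‖y‖ ^ 2 := Real.sq_sqrt hpos
    have hs0 : 0 ≤ s := Real.sqrt_nonneg _
    have hn : ∀ t : ℝ, ‖(z : Eucl (m + 1)) + t • e‖ ^ 2 = ‖y‖ ^ 2 + t ^ 2 := by
      intro t
      have := norm_add_sq_eq_norm_sq_add_norm_sq_of_inner_eq_zero (z : Eucl (m + 1)) (t • e)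
        (by rw [inner_smul_right, hze, mul_zero])
      rw [norm_smul, he1, hzn, mul_one, Real.norm_eq_abs, abs_mul_abs_self] at this
      nlinarith
    refine ⟨z + s • e, ⟨?_, ?_⟩, ?_⟩
    · rw [mem_ball, dist_eq_norm]
      have h3 : (z : Eucl (m + 1)) + s • e - e = z + (s - 1) • e := by module
      rw [h3]
      have h4 := hn (s - 1)
      have hs1 : s ≤ 1 := by nlinarith
      have h5 : (s - 1) ^ 2 ≤ ‖y‖ ^ 2 := by nlinarith
      refine lt_of_pow_lt_pow_left₀ 2 hr0.le ?_
      nlinarith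
    · rw [unitSphere, mem_sphere_zero_iff_norm]
      have h4 := hn s
      rw [hs2] at h4
      have h6 : ‖(z : Eucl (m + 1)) + s • e‖ ^ 2 = 1 ^ 2 := by rw [h4]; ring
      exact (pow_left_inj₀ (norm_nonneg _) zero_le_one two_ne_zero).1 h6
    · have h7 : (ℝ ∙ e)ᗮ.orthogonalProjectionOnto ((z : Eucl (m + 1)) + s • e) = z := by
        rw [map_add, map_smul, Submodule.orthogonalProjectionOnto_mem_subspace_eq_self,
          Submodule.orthogonalProjectionOnto_orthogonal_apply_eq_zero
            (Submodule.mem_span_singleton_self e)]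
        simp
      change U ((ℝ ∙ e)ᗮ.orthogonalProjectionOnto ((z : Eucl (m + 1)) + s • e)) = y
      rw [h7, hz, LinearIsometryEquiv.apply_symm_apply]
  have hcast : (((m + 1 : ℕ) : ℝ) - 1) = m := by push_cast; ring
  rw [sphereMeasure, hcast, Measure.restrict_apply measurableSet_ball]
  have hL := hQ.hausdorffMeasure_image_le (d := m) (by positivity)
    (ball e r ∩ unitSphere (m + 1))
  simp only [ENNReal.coe_one, ENNReal.one_rpow, one_mul] at hL
  refine le_trans ?_ ((measure_mono hball).trans hL)
  rw [Measure.addHaar_ball_mul_of_pos _ _ hr0, finrank_euclideanSpace_fin, mul_comm]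

lemma sphere_net (n : ℕ) (r : ℝ) (hr : 0 < r) : ∃ u : Set (Eucl n), u ⊆ unitSphere n ∧
    u.Countable ∧ (u.PairwiseDisjoint fun a => ball a r) ∧
    unitSphere n ⊆ ⋃ a ∈ u, ball a (5 * r) := by
  obtain ⟨u, hu, hd, hc⟩ := Vitali.exists_disjoint_subfamily_covering_enlargement_closedBall
    (unitSphere n) (fun x => x) (fun _ => r) r (fun _ _ => le_rfl) 4 (by norm_num)
  have hd' : u.PairwiseDisjoint fun a => ball a r := fun a ha b hb hab =>
    (hd ha hb hab).mono ball_subset_closedBall ball_subset_closedBall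
  refine ⟨u, hu, hd'.countable_of_isOpen (fun _ _ => isOpen_ball)
    (fun a _ => ⟨a, mem_ball_self hr⟩), hd', fun x hx => ?_⟩
  obtain ⟨b, hb, h⟩ := hc x hx
  refine mem_biUnion hb ?_
  have h2 : x ∈ closedBall b (4 * r) := h (mem_closedBall_self hr.le)
  exact closedBall_subset_ball (by linarith) h2

lemma integral_compare (m : ℕ) (hm : 1 ≤ m) (p : ℝ) (hp : 1 < p) : ∃ A : ℝ, 0 < A ∧
    ∀ (d : ℝ) (μ : Measure (Eucl (m + 1))), μ (unitSphere (m + 1))ᶜ = 0 → frostman μ d →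
    ∀ δ : ℝ, 0 < δ → δ < 1 → ∀ f : Eucl (m + 1) → ℝ,
    ∫⁻ e, kakeyaMaxFn δ f e ^ p ∂μ ≤ ENNReal.ofReal (A * δ ^ (d - m)) *
      ∫⁻ e, kakeyaMaxFn δ f e ^ p ∂(sphereMeasure (m + 1)) := by
  obtain ⟨N, hN, hK⟩ := kakeya_compare (m + 1)
  obtain ⟨c, hc0, hct, hc⟩ := sphere_lower m hm
  have hp0 : 0 ≤ p := by linarith
  have hcr : 0 < c.toReal := ENNReal.toReal_pos hc0 hct
  have hNr : (0 : ℝ) < N := by exact_mod_cast hN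
  refine ⟨(N : ℝ) ^ p * (N : ℝ) ^ p * 5 ^ m / c.toReal, by positivity, ?_⟩
  intro d μ hμ hF δ h0 h1 f
  obtain ⟨u, hu, huc, hud, hucov⟩ := sphere_net (m + 1) (δ / 5) (by positivity)
  have h5 : 5 * (δ / 5) = δ := by ring
  rw [h5] at hucov
  have := huc.to_subtype
  set S := unitSphere (m + 1) with hS
  have hSm : MeasurableSet S := isClosed_sphere.measurableSet
  set g : Eucl (m + 1) → ℝ≥0∞ := fun e => kakeyaMaxFn δ f e ^ p with hg
  set M : ℝ≥0∞ := ENNReal.ofReal ((N : ℝ) ^ p) with hM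
  have hgc : ∀ e ∈ S, ∀ e' ∈ S, dist e e' ≤ δ → g e ≤ M * g e' := by
    intro e he e' he' hd
    have := hK f e e' (mem_sphere_zero_iff_norm.1 he) (mem_sphere_zero_iff_norm.1 he') δ h0 h1
      (by rwa [← dist_eq_norm])
    calc g e ≤ ((N : ℝ≥0∞) * kakeyaMaxFn δ f e') ^ p := ENNReal.rpow_le_rpow this hp0
      _ = M * g e' := by
        rw [ENNReal.mul_rpow_of_nonneg _ _ hp0, hM, ← ENNReal.ofReal_rpow_of_pos hNr,
          ENNReal.ofReal_natCast]
  -- upper bound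
  have hup : ∫⁻ e, g e ∂μ ≤ ENNReal.ofReal (δ ^ d) * M * ∑' a : u, g a := by
    have hr : μ.restrict (⋃ a : u, ball (a : Eucl (m + 1)) δ ∩ S) = μ := by
      refine Measure.restrict_eq_self_of_ae_mem ?_
      have : ∀ᵐ x ∂μ, x ∈ S := by rw [ae_iff]; exact hμ
      filter_upwards [this] with x hx
      obtain ⟨a, ha, hxa⟩ := mem_iUnion₂.1 (hucov hx)
      exact mem_iUnion.2 ⟨⟨a, ha⟩, hxa, hx⟩
    calc ∫⁻ e, g e ∂μ = ∫⁻ e in (⋃ a : u, ball (a : Eucl (m + 1)) δ ∩ S), g e ∂μ := by rw [hr]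
      _ ≤ ∑' a : u, ∫⁻ e in ball (a : Eucl (m + 1)) δ ∩ S, g e ∂μ := lintegral_iUnion_le _ _
      _ ≤ ∑' a : u, (ENNReal.ofReal (δ ^ d) * M) * g a := by
        refine ENNReal.tsum_le_tsum fun a => ?_
        calc _ ≤ ∫⁻ e in ball (a : Eucl (m + 1)) δ ∩ S, M * g a ∂μ := by
              refine setLIntegral_mono' (measurableSet_ball.inter hSm) fun e he => ?_
              exact hgc e he.2 a (hu a.2) (mem_ball.1 he.1).le
          _ = M * g a * μ (ball (a : Eucl (m + 1)) δ ∩ S) := by rw [setLIntegral_const]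
          _ ≤ M * g a * ENNReal.ofReal (δ ^ d) := by
              gcongr
              exact (measure_mono inter_subset_left).trans (hF a (hu a.2) δ h0)
          _ = _ := by ring
      _ = _ := ENNReal.tsum_mul_left
  -- lower bound
  have hlow : (c * ENNReal.ofReal ((δ / 5) ^ m)) * ∑' a : u, g a ≤
      M * ∫⁻ e, g e ∂(sphereMeasure (m + 1)) := by
    rw [← ENNReal.tsum_mul_left]
    calc _ ≤ ∑' a : u, M * ∫⁻ e in ball (a : Eucl (m + 1)) (δ / 5), g e
            ∂(sphereMeasure (m + 1)) := by
          refine ENNReal.tsum_le_tsum fun a => ?_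
          have hMt : M ≠ ∞ := ENNReal.ofReal_ne_top
          calc _ ≤ sphereMeasure (m + 1) (ball (a : Eucl (m + 1)) (δ / 5)) * g a := by
                gcongr
                exact hc a (hu a.2) _ (by positivity) (by linarith)
            _ = ∫⁻ e in ball (a : Eucl (m + 1)) (δ / 5), g a ∂(sphereMeasure (m + 1)) := by
                rw [setLIntegral_const, mul_comm]
            _ ≤ ∫⁻ e in ball (a : Eucl (m + 1)) (δ / 5), M * g e ∂(sphereMeasure (m + 1)) := by
                refine lintegral_mono_ae ?_
                have hb : ∀ᵐ x ∂((sphereMeasure (m + 1)).restrict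
                    (ball (a : Eucl (m + 1)) (δ / 5))), x ∈ ball (a : Eucl (m + 1)) (δ / 5) :=
                  ae_restrict_mem measurableSet_ball
                have hs : ∀ᵐ x ∂(sphereMeasure (m + 1)), x ∈ S := ae_restrict_mem hSm
                filter_upwards [hb, ae_restrict_of_ae hs] with x hx hxS
                refine hgc a (hu a.2) x hxS ?_
                rw [dist_comm]
                have := mem_ball.1 hx
                linarith
            _ = _ := lintegral_const_mul' _ _ hMt
      _ = M * ∑' a : u, ∫⁻ e in ball (a : Eucl (m + 1)) (δ / 5), g e
            ∂(sphereMeasure (m + 1)) := ENNReal.tsum_mul_left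
      _ = M * ∫⁻ e in ⋃ a : u, ball (a : Eucl (m + 1)) (δ / 5), g e
            ∂(sphereMeasure (m + 1)) := by
          rw [lintegral_iUnion (fun _ => measurableSet_ball)]
          intro a b hab
          exact hud a.2 b.2 (fun h => hab (Subtype.ext h))
      _ ≤ _ := by gcongr; exact Measure.restrict_le_self
  have hδ5 : 0 < (δ / 5) ^ m := by positivity
  have hck : c * ENNReal.ofReal ((δ / 5) ^ m) = ENNReal.ofReal (c.toReal * (δ / 5) ^ m) := by
    rw [ENNReal.ofReal_mul hcr.le, ENNReal.ofReal_toReal hct]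
  rw [hck] at hlow
  set k : ℝ := c.toReal * (δ / 5) ^ m with hk
  have hkpos : 0 < k := by positivity
  have hsum : ∑' a : u, g a ≤ ENNReal.ofReal k⁻¹ *
      (M * ∫⁻ e, g e ∂(sphereMeasure (m + 1))) := by
    calc ∑' a : u, g a = ENNReal.ofReal k⁻¹ * (ENNReal.ofReal k * ∑' a : u, g a) := by
          rw [← mul_assoc, ← ENNReal.ofReal_mul (by positivity), inv_mul_cancel₀ hkpos.ne']
          simp
      _ ≤ _ := by gcongr
  calc _ ≤ ENNReal.ofReal (δ ^ d) * M * (ENNReal.ofReal k⁻¹ *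
      (M * ∫⁻ e, g e ∂(sphereMeasure (m + 1)))) := hup.trans (by gcongr)
    _ = (ENNReal.ofReal (δ ^ d) * M * ENNReal.ofReal k⁻¹ * M) *
        ∫⁻ e, g e ∂(sphereMeasure (m + 1)) := by ring
    _ = _ := by
      congr 1
      rw [hM, ← ENNReal.ofReal_mul (by positivity), ← ENNReal.ofReal_mul (by positivity),
        ← ENNReal.ofReal_mul (by positivity)]
      congr 1
      rw [Real.rpow_sub h0, Real.rpow_natCast, hk, div_pow]
      field_simp


/-- For `n ≥ 2`, `1 < p < ∞` and `0 ≤ d ≤ n-1` there is a constant `C(n,d,p) > 0` such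
that for every Borel probability measure `μ` on `S^{n-1}` with `[μ]_d ≤ 1` and every
`δ ∈ (0,1)` one has `‖K_δ‖_{μ,p} ≤ C(n,d,p) δ^{-(n-(d+1))/p} ‖K_δ‖_{σ,p}`. -/
theorem stmt4 (n : ℕ) (hn : 2 ≤ n) (p : ℝ) (hp : 1 < p)
    (d : ℝ) (hd : d ∈ Set.Icc (0 : ℝ) ((n : ℝ) - 1)) :
    ∃ C : ℝ, 0 < C ∧
      ∀ μ : Measure (Eucl n), IsProbabilityMeasure μ → μ (unitSphere n)ᶜ = 0 →
        frostman μ d →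
          ∀ δ ∈ Set.Ioo (0 : ℝ) 1,
            kakeyaNorm μ p δ ≤
              ENNReal.ofReal (C * δ ^ (-(((n : ℝ) - (d + 1)) / p))) *
                kakeyaNorm (sphereMeasure n) p δ := by
  obtain ⟨m, rfl⟩ : ∃ m, n = m + 1 := ⟨n - 1, by omega⟩
  obtain ⟨A, hA, h⟩ := integral_compare m (by omega) p hp
  have hp0 : 0 < p := by linarith
  refine ⟨A ^ (1 / p), by positivity, ?_⟩
  intro μ _ hμ hF δ hδ
  refine iSup₂_le fun f hf => ?_
  calc _ ≤ (ENNReal.ofReal (A * δ ^ (d - m)) *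
      ∫⁻ e, kakeyaMaxFn δ f e ^ p ∂(sphereMeasure (m + 1))) ^ (1 / p) :=
        ENNReal.rpow_le_rpow (h d μ hμ hF δ hδ.1 hδ.2 f) (by positivity)
    _ = ENNReal.ofReal (A ^ (1 / p) * δ ^ (-((((m + 1 : ℕ) : ℝ) - (d + 1)) / p))) *
        (∫⁻ e, kakeyaMaxFn δ f e ^ p ∂(sphereMeasure (m + 1))) ^ (1 / p) := by
      have hδ0 := hδ.1
      rw [ENNReal.mul_rpow_of_nonneg _ _ (by positivity),
        ENNReal.ofReal_rpow_of_pos (by positivity), Real.mul_rpow hA.le (by positivity),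
        ← Real.rpow_mul hδ0.le]
      congr 4
      push_cast
      ring
    _ ≤ _ := by
      gcongr
      exact le_iSup₂ (f := fun (f : Eucl (m + 1) → ℝ)
        (_ : f ∈ {f : Eucl (m + 1) → ℝ | eLpNorm f (ENNReal.ofReal p) volume ≤ 1}) =>
        (∫⁻ e, kakeyaMaxFn δ f e ^ p ∂(sphereMeasure (m + 1))) ^ (1 / p)) f hf

end
end

section
/- (Sum-difference theorem) For every constant C > 0 there is a constant C' > 0 such that the following holds for every n ≥ 1, every δ > 0 and every N ≥ 1: if A, B are finite subsets of the lattice δℤⁿ with #A ≤ N and #B ≤ N, and G ⊆ A × B satisfies #{ a + b : (a,b) ∈ G } ≤ C·N, then #{ a − b : (a,b) ∈ G } ≤ C'·N^{11/6}. -/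
open MeasureTheory Metric Set
open scoped ENNReal NNReal RealInnerProductSpace

noncomputable section

section SumDiffHelpers

open Finset in
/-- The sum of the reciprocals of the fibre sizes is at most the size of the codomain. -/
lemma sum_inv_fiber_le {α β : Type*} [DecidableEq β] (V : Finset α) (Y : Finset β)
    (f : α → β) (hf : ∀ v ∈ V, f v ∈ Y) :
    ∑ v ∈ V, ((#{w ∈ V | f w = f v} : ℕ) : ℝ)⁻¹ ≤ (#Y : ℝ) := by
  rw [← Finset.sum_fiberwise_of_maps_to hf]
  have : ∀ y ∈ Y, ∑ v ∈ V with f v = y, ((#{w ∈ V | f w = f v} : ℕ) : ℝ)⁻¹ ≤ 1 := by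
    intro y _
    have h : ∑ v ∈ V with f v = y, ((#{w ∈ V | f w = f v} : ℕ) : ℝ)⁻¹
        = ∑ v ∈ V with f v = y, ((#{w ∈ V | f w = y} : ℕ) : ℝ)⁻¹ := by
      refine Finset.sum_congr rfl fun v hv => ?_
      rw [(Finset.mem_filter.1 hv).2]
    rw [h, Finset.sum_const, nsmul_eq_mul]
    exact mul_inv_le_one
  calc _ ≤ ∑ y ∈ Y, (1 : ℝ) := Finset.sum_le_sum this
    _ = _ := by simp

lemma three_le_aux (x y : ℝ) (hx : 0 < x) (hy : 0 < y) : 3 ≤ x * y + x⁻¹ + y⁻¹ := by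
  obtain ⟨a, ha, rfl⟩ : ∃ a : ℝ, 0 < a ∧ a ^ 2 = x := ⟨√x, Real.sqrt_pos.2 hx, Real.sq_sqrt hx.le⟩
  obtain ⟨b, hb, rfl⟩ : ∃ b : ℝ, 0 < b ∧ b ^ 2 = y := ⟨√y, Real.sqrt_pos.2 hy, Real.sq_sqrt hy.le⟩
  have hs : 0 < a * b := mul_pos ha hb
  have h1 : 0 ≤ (a * b) * ((a * b - 1) ^ 2 * (a * b + 2)) := by positivity
  have h2 : 0 ≤ (a - b) ^ 2 := sq_nonneg _
  have : a ^ 2 * b ^ 2 + (a ^ 2)⁻¹ + (b ^ 2)⁻¹ - 3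
      = ((a * b) * ((a * b - 1) ^ 2 * (a * b + 2)) + (a - b) ^ 2) / (a ^ 2 * b ^ 2) := by
    field_simp
    ring
  have h3 : 0 ≤ ((a * b) * ((a * b - 1) ^ 2 * (a * b + 2)) + (a - b) ^ 2) / (a ^ 2 * b ^ 2) := by
    positivity
  linarith

lemma two_le_aux (x : ℝ) (hx : 0 < x) : 2 ≤ x + x⁻¹ := by
  have : x + x⁻¹ - 2 = (x - 1) ^ 2 / x := by field_simp; ring
  have : 0 ≤ (x - 1) ^ 2 / x := by positivity
  linarith

lemma sum_holder2 {α : Type*} (V : Finset α) (d : α → ℝ) (Y : ℝ)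
    (hd : ∀ v ∈ V, 0 < d v) (hs : ∑ v ∈ V, (d v)⁻¹ ≤ Y) :
    (V.card : ℝ) ^ 2 ≤ Y * ∑ v ∈ V, d v := by
  rcases V.eq_empty_or_nonempty with rfl | hV
  · simp
  have hY : 0 < Y := (Finset.sum_pos (fun v hv => inv_pos.2 (hd v hv)) hV).trans_le hs
  have hm : (0 : ℝ) < V.card := by exact_mod_cast hV.card_pos
  obtain ⟨m, hmdef⟩ : ∃ m : ℝ, m = V.card := ⟨_, rfl⟩
  rw [← hmdef] at hm ⊢
  have key : ∑ v ∈ V, (2 : ℝ) ≤ ∑ v ∈ V, ((Y / m) * d v + (m / Y) * (d v)⁻¹) := by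
    refine Finset.sum_le_sum fun v hv => ?_
    have h := two_le_aux ((Y / m) * d v) (by have := hd v hv; positivity)
    rwa [mul_inv, inv_div] at h
  rw [Finset.sum_add_distrib, ← Finset.mul_sum, ← Finset.mul_sum, Finset.sum_const,
    nsmul_eq_mul, ← hmdef] at key
  have h1 : (m / Y) * ∑ v ∈ V, (d v)⁻¹ ≤ m := by
    calc _ ≤ (m / Y) * Y := by gcongr
      _ = m := by field_simp
  have h2 : m ≤ (Y / m) * ∑ v ∈ V, d v := by linarith
  calc m ^ 2 = m * m := by ring
    _ ≤ m * ((Y / m) * ∑ v ∈ V, d v) := by gcongr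
    _ = _ := by field_simp

lemma sum_holder3 {α : Type*} (V : Finset α) (d e : α → ℝ) (Y Z : ℝ)
    (hd : ∀ v ∈ V, 0 < d v) (he : ∀ v ∈ V, 0 < e v)
    (hs : ∑ v ∈ V, (d v)⁻¹ ≤ Y) (ht : ∑ v ∈ V, (e v)⁻¹ ≤ Z) :
    (V.card : ℝ) ^ 3 ≤ Y * Z * ∑ v ∈ V, d v * e v := by
  rcases V.eq_empty_or_nonempty with rfl | hV
  · simp
  have hY : 0 < Y := (Finset.sum_pos (fun v hv => inv_pos.2 (hd v hv)) hV).trans_le hs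
  have hZ : 0 < Z := (Finset.sum_pos (fun v hv => inv_pos.2 (he v hv)) hV).trans_le ht
  have hm : (0 : ℝ) < V.card := by exact_mod_cast hV.card_pos
  obtain ⟨m, hmdef⟩ : ∃ m : ℝ, m = V.card := ⟨_, rfl⟩
  rw [← hmdef] at hm ⊢
  have key : ∑ v ∈ V, (3 : ℝ) ≤ ∑ v ∈ V, ((Y * Z / m ^ 2) * (d v * e v) + (m / Y) * (d v)⁻¹
      + (m / Z) * (e v)⁻¹) := by
    refine Finset.sum_le_sum fun v hv => ?_
    have h := three_le_aux ((Y / m) * d v) ((Z / m) * e v)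
      (by have := hd v hv; positivity) (by have := he v hv; positivity)
    rw [mul_inv, inv_div, mul_inv, inv_div] at h
    calc _ ≤ _ := h
      _ = _ := by ring
  rw [Finset.sum_add_distrib, Finset.sum_add_distrib, ← Finset.mul_sum, ← Finset.mul_sum,
    ← Finset.mul_sum, Finset.sum_const, nsmul_eq_mul, ← hmdef] at key
  have h1 : (m / Y) * ∑ v ∈ V, (d v)⁻¹ ≤ m := by
    calc _ ≤ (m / Y) * Y := by gcongr
      _ = m := by field_simp
  have h1' : (m / Z) * ∑ v ∈ V, (e v)⁻¹ ≤ m := by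
    calc _ ≤ (m / Z) * Z := by gcongr
      _ = m := by field_simp
  have h2 : m ≤ (Y * Z / m ^ 2) * ∑ v ∈ V, d v * e v := by linarith
  calc m ^ 3 = m ^ 2 * m := by ring
    _ ≤ m ^ 2 * ((Y * Z / m ^ 2) * ∑ v ∈ V, d v * e v) := by gcongr
    _ = _ := by field_simp

lemma final_aux (g a b s v t : ℝ) (ha : 0 ≤ a) (hb : 0 ≤ b) (hs : 0 ≤ s) (hv : 0 ≤ v)
    (h1 : g ^ 2 ≤ a * v) (h2 : v ^ 3 ≤ b * b * (b * s) * t) (h3 : t ≤ s ^ 2 * a * b) :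
    g ^ 6 ≤ a ^ 4 * b ^ 4 * s ^ 3 := by
  calc g ^ 6 = (g ^ 2) ^ 3 := by ring
    _ ≤ (a * v) ^ 3 := by gcongr
    _ = a ^ 3 * v ^ 3 := by ring
    _ ≤ a ^ 3 * (b * b * (b * s) * t) := by gcongr
    _ ≤ a ^ 3 * (b * b * (b * s) * (s ^ 2 * a * b)) := by gcongr
    _ = _ := by ring

open Finset in
/-- The combinatorial core: `|G|^6 ≤ |A|^4 |B|^4 |S|^3` when `a - b` is injective on `G`. -/
lemma sumdiff_core {α : Type*} [AddCommGroup α] [DecidableEq α] (A B S : Finset α)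
    (G : Finset (α × α)) (hA : ∀ g ∈ G, g.1 ∈ A) (hB : ∀ g ∈ G, g.2 ∈ B)
    (hS : ∀ g ∈ G, g.1 + g.2 ∈ S)
    (hinj : ∀ g ∈ G, ∀ h ∈ G, g.1 - g.2 = h.1 - h.2 → g = h) :
    (#G : ℝ) ^ 6 ≤ (#A : ℝ) ^ 4 * (#B : ℝ) ^ 4 * (#S : ℝ) ^ 3 := by
  classical
  -- pairs sharing their first coordinate
  set V : Finset ((α × α) × (α × α)) := {v ∈ G ×ˢ G | v.2.1 = v.1.1} with hVdef
  have hV : ∀ v ∈ V, v.1 ∈ G ∧ v.2 ∈ G ∧ v.2.1 = v.1.1 := by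
    intro v hv
    simp only [hVdef, mem_filter, mem_product] at hv
    tauto
  have hVcard : (#V : ℝ) = ∑ g ∈ G, ((#{h ∈ G | h.1 = g.1} : ℕ) : ℝ) := by
    rw [hVdef, Finset.card_filter, Finset.sum_product]
    push_cast
    refine Finset.sum_congr rfl fun g _ => ?_
    rw [Finset.card_filter]
    push_cast
    rfl
  have hV2 : (#G : ℝ) ^ 2 ≤ #A * #V := by
    rw [hVcard]
    refine sum_holder2 G _ _ ?_ (sum_inv_fiber_le G A (fun g => g.1) hA)
    intro g hg
    have : 0 < #{h ∈ G | h.1 = g.1} := Finset.card_pos.2 ⟨g, by simp [hg]⟩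
    exact_mod_cast this
  let f1 : (α × α) × (α × α) → α × α := fun v => (v.1.2, v.2.2)
  let f2 : (α × α) × (α × α) → α × α := fun v => (v.1.2, v.2.1 + v.2.2)
  have hV3 := sum_holder3 V (fun v => ((#{w ∈ V | f1 w = f1 v} : ℕ) : ℝ))
    (fun v => ((#{w ∈ V | f2 w = f2 v} : ℕ) : ℝ)) (#(B ×ˢ B) : ℝ) (#(B ×ˢ S) : ℝ)
    (by
      intro v hv
      have : 0 < #{w ∈ V | f1 w = f1 v} := Finset.card_pos.2 ⟨v, by simp [hv]⟩
      exact_mod_cast this)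
    (by
      intro v hv
      have : 0 < #{w ∈ V | f2 w = f2 v} := Finset.card_pos.2 ⟨v, by simp [hv]⟩
      exact_mod_cast this)
    (sum_inv_fiber_le V _ f1 (by
      intro v hv
      obtain ⟨h1, h2, h3⟩ := hV v hv
      exact mem_product.2 ⟨hB v.1 h1, hB v.2 h2⟩))
    (sum_inv_fiber_le V _ f2 (by
      intro v hv
      obtain ⟨h1, h2, h3⟩ := hV v hv
      exact mem_product.2 ⟨hB v.1 h1, hS v.2 h2⟩))
  -- triples
  let T := V.sigma fun v => ({w ∈ V | f1 w = f1 v} : Finset _) ×ˢ ({w ∈ V | f2 w = f2 v} : Finset _)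
  have hT : ∑ v ∈ V, ((#{w ∈ V | f1 w = f1 v} : ℕ) : ℝ) * ((#{w ∈ V | f2 w = f2 v} : ℕ) : ℝ)
      = (#T : ℝ) := by
    simp only [T, Finset.card_sigma, Finset.card_product]
    push_cast
    rfl
  have hTle : #T ≤ #((S ×ˢ S) ×ˢ (A ×ˢ B)) := by
    refine Finset.card_le_card_of_injOn
      (fun t => ((t.2.1.1.1 + t.2.1.1.2, t.2.1.2.1 + t.2.1.2.2), (t.1.1.1, t.2.2.2.2))) ?_ ?_
    · intro t ht
      simp only [T, mem_coe, mem_sigma, mem_product, mem_filter] at ht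
      obtain ⟨h1, ⟨h2, -⟩, h3, -⟩ := ht
      obtain ⟨a1, -, -⟩ := hV _ h1
      obtain ⟨b1, b2, -⟩ := hV _ h2
      obtain ⟨-, c2, -⟩ := hV _ h3
      simp only [mem_coe, mem_product]
      exact ⟨⟨hS _ b1, hS _ b2⟩, hA _ a1, hB _ c2⟩
    · rintro ⟨⟨⟨a1, b1⟩, ⟨a1', c1⟩⟩, ⟨⟨a0, b0⟩, ⟨a0', c0⟩⟩, ⟨⟨a2, b2⟩, ⟨a2', c2⟩⟩⟩ ht
        ⟨⟨⟨x1, y1⟩, ⟨x1', z1⟩⟩, ⟨⟨x0, y0⟩, ⟨x0', z0⟩⟩, ⟨⟨x2, y2⟩, ⟨x2', z2⟩⟩⟩ hu htu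
      simp only [T, mem_coe, mem_sigma, mem_product, mem_filter, f1, f2, Prod.mk.injEq] at ht hu htu
      obtain ⟨t1, ⟨t0, t01, t01'⟩, t2, t12, t12'⟩ := ht
      obtain ⟨u1, ⟨u0, u01, u01'⟩, u2, u12, u12'⟩ := hu
      obtain ⟨⟨e1, e2⟩, e3, e4⟩ := htu
      obtain ⟨-, -, p1⟩ := hV _ t1
      obtain ⟨-, -, p0⟩ := hV _ t0
      obtain ⟨q2, -, p2⟩ := hV _ t2
      obtain ⟨-, -, r1⟩ := hV _ u1
      obtain ⟨-, -, r0⟩ := hV _ u0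
      obtain ⟨s2, -, r2⟩ := hV _ u2
      dsimp only at p0 p1 p2 r0 r1 r2 q2 s2
      subst p0 p1 p2 r0 r1 r2 t01 t01' t12 u01 u01' u12 e3 e4
      have hd : a2' - b2 = x2' - y2 := by
        have h1 : a2' = a1' + c0 - c2 := by rw [← t12']; abel
        have h2 : x2' = a1' + z0 - c2 := by rw [← u12']; abel
        have h3 : c0 - b2 = z0 - y2 := by
          calc c0 - b2 = (a0' + c0) - (a0' + b2) := by abel
            _ = (x0' + z0) - (x0' + y2) := by rw [e1, e2]
            _ = _ := by abel
        calc a2' - b2 = a1' - c2 + (c0 - b2) := by rw [h1]; abel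
          _ = a1' - c2 + (z0 - y2) := by rw [h3]
          _ = _ := by rw [h2]; abel
      have := hinj _ q2 _ s2 hd
      simp only [Prod.mk.injEq] at this
      obtain ⟨rfl, rfl⟩ := this
      have : a0' = x0' := add_right_cancel e1
      subst this
      have : c0 = z0 := add_left_cancel e2
      subst this
      rfl
  rw [hT] at hV3
  have hTle' : (#T : ℝ) ≤ (#S : ℝ) ^ 2 * #A * #B := by
    have : (#T : ℝ) ≤ (#((S ×ˢ S) ×ˢ (A ×ˢ B)) : ℕ) := by exact_mod_cast hTle
    refine this.trans (le_of_eq ?_)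
    simp only [Finset.card_product]
    push_cast
    ring
  simp only [Finset.card_product] at hV3
  push_cast at hV3
  exact final_aux _ _ _ _ _ _ (by positivity) (by positivity) (by positivity) (by positivity) hV2 hV3 hTle'

end SumDiffHelpers

/-- Sum-difference theorem: for every `C > 0` there is `C' > 0` such that for all
`n ≥ 1`, `δ > 0`, `N ≥ 1`, all finite `A, B ⊆ δℤⁿ` with `#A, #B ≤ N`, and all
`G ⊆ A × B` with `#{a + b : (a,b) ∈ G} ≤ C·N`, one has
`#{a - b : (a,b) ∈ G} ≤ C'·N^{11/6}`. -/
theorem stmt13 :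
    ∀ C : ℝ, 0 < C → ∃ C' : ℝ, 0 < C' ∧
      ∀ n : ℕ, 1 ≤ n → ∀ δ : ℝ, 0 < δ → ∀ N : ℕ, 1 ≤ N →
        ∀ A B : Set (Eucl n), A.Finite → B.Finite →
          (∀ a ∈ A, ∀ i : Fin n, ∃ k : ℤ, a i = δ * k) →
          (∀ b ∈ B, ∀ i : Fin n, ∃ k : ℤ, b i = δ * k) →
          A.ncard ≤ N → B.ncard ≤ N →
          ∀ G ⊆ A ×ˢ B,
            (({p.1 + p.2 | p ∈ G} : Set (Eucl n)).ncard : ℝ) ≤ C * N →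
            (({p.1 - p.2 | p ∈ G} : Set (Eucl n)).ncard : ℝ) ≤
              C' * (N : ℝ) ^ ((11 : ℝ) / 6) := by
  classical
  intro C hC
  refine ⟨√C, Real.sqrt_pos.2 hC, ?_⟩
  intro n _ δ _ N hN A B hAf hBf _ _ hAN hBN G hG hS
  have hGf : G.Finite := (hAf.prod hBf).subset hG
  -- one pair for each difference
  obtain ⟨G', hG'G, hG'⟩ : ∃ G' ⊆ G, Set.BijOn (fun p : Eucl n × Eucl n => p.1 - p.2) G'
      ((fun p : Eucl n × Eucl n => p.1 - p.2) '' G) :=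
    Set.SurjOn.exists_bijOn_subset (Set.surjOn_image _ _)
  have hG'f : G'.Finite := hGf.subset hG'G
  have hSf : ((fun p : Eucl n × Eucl n => p.1 + p.2) '' G).Finite := hGf.image _
  have hcore := sumdiff_core hAf.toFinset hBf.toFinset hSf.toFinset hG'f.toFinset
    (fun g hg => by
      rw [Set.Finite.mem_toFinset] at hg ⊢
      exact (hG (hG'G hg)).1)
    (fun g hg => by
      rw [Set.Finite.mem_toFinset] at hg ⊢
      exact (hG (hG'G hg)).2)
    (fun g hg => by
      rw [Set.Finite.mem_toFinset] at hg ⊢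
      exact ⟨g, hG'G hg, rfl⟩)
    (fun g hg h hh e => by
      rw [Set.Finite.mem_toFinset] at hg hh
      exact hG'.injOn hg hh e)
  simp only [← Set.ncard_eq_toFinset_card] at hcore
  have hD : ({p.1 - p.2 | p ∈ G} : Set (Eucl n)).ncard = G'.ncard := by
    change ((fun p : Eucl n × Eucl n => p.1 - p.2) '' G).ncard = _
    rw [← hG'.image_eq, hG'.injOn.ncard_image]
  rw [hD]
  have hS' : ((((fun p : Eucl n × Eucl n => p.1 + p.2) '' G).ncard : ℕ) : ℝ) ≤ C * N := hS
  have hA' : (A.ncard : ℝ) ≤ N := by exact_mod_cast hAN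
  have hB' : (B.ncard : ℝ) ≤ N := by exact_mod_cast hBN
  have h6 : (G'.ncard : ℝ) ^ 6 ≤ (N : ℝ) ^ 4 * (N : ℝ) ^ 4 * (C * N) ^ 3 :=
    hcore.trans (by gcongr)
  refine le_of_pow_le_pow_left₀ (n := 6) (by norm_num) (by positivity) (h6.trans (le_of_eq ?_))
  have e1 : √C ^ 6 = C ^ 3 := by
    calc √C ^ 6 = (√C ^ 2) ^ 3 := by ring
      _ = C ^ 3 := by rw [Real.sq_sqrt hC.le]
  have e2 : ((N : ℝ) ^ ((11 : ℝ) / 6)) ^ 6 = (N : ℝ) ^ 11 := by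
    rw [← Real.rpow_natCast, ← Real.rpow_mul (by positivity), ← Real.rpow_natCast]
    norm_num
  rw [mul_pow (√C), e1, e2]
  ring

end
end

section
/- (Heath-Brown) There exist an absolute constant c > 0 and an integer M₀ such that for every integer M > M₀ and every subset S ⊆ {0, 1, …, M} with #S ≥ M/(log M)^c, there exist integers m ≥ 0 and m' ≥ 1 with {m, m + m', m + 2m'} ⊆ S, i.e. S contains a nontrivial three-term arithmetic progression. -/
namespace HB

/-- The Fourier transform on `ZMod (2N+1)` of a function on a finite set of integers. -/
noncomputable def FT (N : ℕ) (S : Finset ℤ) (f : ℤ → ℝ) (r : ZMod (2 * N + 1)) : ℂ :=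
  ∑ x ∈ S, (f x : ℂ) * ZMod.stdAddChar (r * (x : ZMod (2 * N + 1)))

/-- No nontrivial three-term progressions. -/
def Free (A : Finset ℤ) : Prop :=
  ∀ x ∈ A, ∀ y ∈ A, ∀ z ∈ A, x + z = 2 * y → x = z

lemma cast_zero_iff (N : ℕ) (d : ℤ) (hd : |d| ≤ 2 * N) :
    ((d : ZMod (2 * N + 1)) = 0) ↔ d = 0 := by
  constructor
  · intro h
    rw [ZMod.intCast_zmod_eq_zero_iff_dvd] at h
    apply Int.eq_zero_of_abs_lt_dvd h
    push_cast
    omega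
  · rintro rfl; simp

lemma orth (N : ℕ) (d : ℤ) (hd : |d| ≤ 2 * N) :
    ∑ r : ZMod (2 * N + 1), (ZMod.stdAddChar (r * (d : ZMod (2 * N + 1))) : ℂ)
      = if d = 0 then (2 * N + 1 : ℂ) else 0 := by
  have := AddChar.sum_mulShift (ψ := (ZMod.stdAddChar : AddChar (ZMod (2 * N + 1)) ℂ))
    (d : ZMod (2 * N + 1)) (ZMod.isPrimitive_stdAddChar _)
  rw [this]
  simp only [cast_zero_iff N d hd, ZMod.card]
  split_ifs <;> simp

lemma conj_char (N : ℕ) (a : ZMod (2 * N + 1)) :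
    (starRingEnd ℂ) (ZMod.stdAddChar a : ℂ) = ZMod.stdAddChar (-a) := by
  rw [AddChar.map_neg_eq_conj]

lemma norm_char (N : ℕ) (a : ZMod (2 * N + 1)) :
    ‖(ZMod.stdAddChar a : ℂ)‖ = 1 := by
  rw [ZMod.stdAddChar_apply]; exact Circle.norm_coe _

lemma parseval (N : ℕ) (S : Finset ℤ) (hS : ∀ x ∈ S, -(N : ℤ) ≤ x ∧ x ≤ N) (f : ℤ → ℝ) :
    ∑ r, ‖FT N S f r‖ ^ 2 = (2 * N + 1) * ∑ x ∈ S, f x ^ 2 := by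
  have key : (∑ r, (FT N S f r) * (starRingEnd ℂ) (FT N S f r))
      = (2 * N + 1) * ∑ x ∈ S, (f x : ℂ) ^ 2 := by
    have h1 : ∀ r, (FT N S f r) * (starRingEnd ℂ) (FT N S f r)
        = ∑ x ∈ S, ∑ y ∈ S, (f x : ℂ) * f y *
          ZMod.stdAddChar (r * ((x - y : ℤ) : ZMod (2 * N + 1))) := by
      intro r
      rw [FT, map_sum, Finset.sum_mul_sum]
      refine Finset.sum_congr rfl fun x _ => Finset.sum_congr rfl fun y _ => ?_
      rw [map_mul (starRingEnd ℂ), conj_char, Complex.conj_ofReal]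
      have : r * ((x - y : ℤ) : ZMod (2 * N + 1)) = r * x + -(r * y) := by push_cast; ring
      rw [this, AddChar.map_add_eq_mul]
      ring
    simp_rw [h1]
    rw [Finset.sum_comm, Finset.mul_sum]
    refine Finset.sum_congr rfl fun x hx => ?_
    rw [Finset.sum_comm]
    simp_rw [← Finset.mul_sum]
    rw [Finset.sum_eq_single x]
    · rw [orth]
      · simp; ring
      · simp
    · intro y hy hxy
      rw [orth]
      · rw [if_neg (by omega)]; simp
      · have := hS x hx; have := hS y hy
        rw [abs_le]; constructor <;> omega
    · intro h; exact absurd hx h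
  have h2 : ((∑ r, ‖FT N S f r‖ ^ 2 : ℝ) : ℂ) = (((2 * N + 1) * ∑ x ∈ S, f x ^ 2 : ℝ) : ℂ) := by
    push_cast
    rw [← key]
    refine Finset.sum_congr rfl fun r _ => ?_
    rw [Complex.mul_conj, Complex.normSq_eq_norm_sq]
    push_cast; rfl
  exact_mod_cast h2

/-- trilinear form -/
noncomputable def T (N : ℕ) (f : ℤ → ℝ) : ℝ :=
  ∑ x ∈ Finset.Ico (0 : ℤ) N, ∑ z ∈ Finset.Ico (0 : ℤ) N, ∑ y ∈ Finset.Ico (0 : ℤ) N,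
    if x + z = 2 * y then f x * f z * f y else 0

lemma trilinear (N : ℕ) (f : ℤ → ℝ) :
    ∑ r, FT N (Finset.Ico 0 N) f r * FT N (Finset.Ico 0 N) f r * FT N (Finset.Ico 0 N) f (-2 * r)
      = (2 * N + 1) * (T N f : ℂ) := by
  have h1 : ∀ r, FT N (Finset.Ico 0 N) f r * FT N (Finset.Ico 0 N) f r *
        FT N (Finset.Ico 0 N) f (-2 * r)
      = ∑ x ∈ Finset.Ico (0 : ℤ) N, ∑ z ∈ Finset.Ico (0 : ℤ) N, ∑ y ∈ Finset.Ico (0 : ℤ) N,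
        (f x : ℂ) * f z * f y *
          ZMod.stdAddChar (r * ((x + z - 2 * y : ℤ) : ZMod (2 * N + 1))) := by
    intro r
    rw [FT, FT, Finset.sum_mul_sum, Finset.sum_mul]
    refine Finset.sum_congr rfl fun x _ => ?_
    rw [Finset.sum_mul]
    refine Finset.sum_congr rfl fun z _ => ?_
    rw [Finset.mul_sum]
    refine Finset.sum_congr rfl fun y _ => ?_
    have : r * ((x + z - 2 * y : ℤ) : ZMod (2 * N + 1)) = r * x + r * z + (-2 * r * y) := by
      push_cast; ring
    rw [this, AddChar.map_add_eq_mul, AddChar.map_add_eq_mul]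
    ring
  simp_rw [h1]
  rw [Finset.sum_comm, T]
  simp only [Complex.ofReal_sum]
  rw [Finset.mul_sum]
  refine Finset.sum_congr rfl fun x hx => ?_
  rw [Finset.sum_comm, Finset.mul_sum]
  refine Finset.sum_congr rfl fun z hz => ?_
  rw [Finset.sum_comm, Finset.mul_sum]
  refine Finset.sum_congr rfl fun y hy => ?_
  rw [← Finset.mul_sum, orth]
  · by_cases h : x + z = 2 * y
    · rw [if_pos (by omega), if_pos h]; push_cast; ring
    · rw [if_neg (by omega), if_neg h]; simp
  · simp only [Finset.mem_Ico] at hx hy hz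
    rw [abs_le]; constructor <;> omega

lemma sum_dilate (N : ℕ) (g : ZMod (2 * N + 1) → ℝ) :
    ∑ r, g (-2 * r) = ∑ r, g r := by
  have hu : (-2 : ZMod (2 * N + 1)) * (N : ZMod (2 * N + 1)) = 1 := by
    have : ((2 * N + 1 : ℕ) : ZMod (2 * N + 1)) = 0 := ZMod.natCast_self _
    push_cast at this
    linear_combination -this
  let e : ZMod (2 * N + 1) ≃ ZMod (2 * N + 1) :=
    { toFun := fun r => -2 * r
      invFun := fun r => (N : ZMod (2 * N + 1)) * r
      left_inv := fun r => by
        show (N : ZMod (2 * N + 1)) * (-2 * r) = r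
        linear_combination r * hu
      right_inv := fun r => by
        show -2 * ((N : ZMod (2 * N + 1)) * r) = r
        linear_combination r * hu }
  exact e.sum_comp g

lemma T_free (N : ℕ) (A : Finset ℤ) (hF : Free A) :
    T N (fun x => if x ∈ A then 1 else 0) ≤ A.card := by
  have h : ∀ x ∈ Finset.Ico (0 : ℤ) N, (∑ z ∈ Finset.Ico (0 : ℤ) N, ∑ y ∈ Finset.Ico (0 : ℤ) N,
    if x + z = 2 * y then (if x ∈ A then (1:ℝ) else 0) * (if z ∈ A then 1 else 0) *
      (if y ∈ A then 1 else 0) else 0) ≤ if x ∈ A then 1 else 0 := by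
    intro x hx
    by_cases hxA : x ∈ A
    swap
    · simp [hxA]
    rw [Finset.sum_eq_single x, Finset.sum_eq_single x]
    · simp [hxA]; split_ifs <;> norm_num
    · intro y _ hy
      rw [if_neg (by omega)]
    · intro h; exact absurd hx h
    · intro z _ hz
      refine Finset.sum_eq_zero fun y _ => ?_
      split_ifs with h1 h2 h3 <;> simp
      exact hz (hF x hxA y h3 z h2 h1).symm
    · intro h; exact absurd hx h
  refine (Finset.sum_le_sum h).trans ?_
  rw [← Finset.sum_filter, Finset.sum_const, nsmul_eq_mul, mul_one]
  exact_mod_cast Finset.card_le_card (fun x hx => (Finset.mem_filter.1 hx).2)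

lemma T_one (N : ℕ) (a : ℝ) (ha : 0 ≤ a) :
    a ^ 3 * ((N : ℝ) ^ 2 / 4) ≤ T N (fun _ => a) := by
  have hle : ∀ M : ℕ, N = 2 * M ∨ N + 1 = 2 * M → (M : ℝ) ^ 2 * a ^ 3 ≤ T N (fun _ => a) := by
    intro M hM
    have e1 : T N (fun _ => a) = ∑ p ∈ (Finset.Ico (0 : ℤ) N ×ˢ Finset.Ico (0 : ℤ) N ×ˢ
        Finset.Ico (0 : ℤ) N).filter (fun p => p.1 + p.2.1 = 2 * p.2.2), a ^ 3 := by
      rw [Finset.sum_filter, Finset.sum_product, T]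
      refine Finset.sum_congr rfl fun x _ => ?_
      rw [Finset.sum_product]
      refine Finset.sum_congr rfl fun z _ => Finset.sum_congr rfl fun y _ => ?_
      congr 1; ring
    rw [e1, Finset.sum_const, nsmul_eq_mul]
    apply mul_le_mul_of_nonneg_right _ (by positivity)
    have : (Finset.range M ×ˢ Finset.range M).card ≤ ((Finset.Ico (0 : ℤ) N ×ˢ
        Finset.Ico (0 : ℤ) N ×ˢ
        Finset.Ico (0 : ℤ) N).filter (fun p => p.1 + p.2.1 = 2 * p.2.2)).card := by
      apply Finset.card_le_card_of_injOn (fun p => (2 * (p.1 : ℤ), 2 * (p.2 : ℤ), (p.1 : ℤ) + p.2))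
      · intro p hp
        simp only [Finset.coe_product, Finset.coe_range, Set.mem_prod, Set.mem_Iio] at hp
        simp only [Finset.coe_filter, Finset.mem_product, Finset.mem_Ico, Set.mem_ofPred_eq]
        omega
      · intro p _ p' _ h
        simp only [Prod.mk.injEq] at h
        ext <;> omega
    rw [Finset.card_product, Finset.card_range] at this
    rw [sq]; exact_mod_cast this
  rcases Nat.even_or_odd' N with ⟨M, h | h⟩
  · refine le_trans (le_of_eq ?_) (hle M (Or.inl h))
    rw [h]; push_cast; ring
  · refine le_trans ?_ (hle (M + 1) (Or.inr (by omega)))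
    rw [mul_comm]
    apply mul_le_mul_of_nonneg_right _ (by positivity)
    rw [h]; push_cast
    have : (0 : ℝ) ≤ M := Nat.cast_nonneg M
    nlinarith

end HB
namespace HB

lemma FT_norm_le (N : ℕ) (S : Finset ℤ) (r) : ‖FT N S (fun _ => 1) r‖ ≤ S.card := by
  refine (norm_sum_le _ _).trans ?_
  simp

lemma cubeI (N : ℕ) :
    ∑ r, ‖FT N (Finset.Ico 0 N) (fun _ => 1) r‖ ^ 3 ≤ (2 * N + 1) * (N : ℝ) ^ 2 := by
  have h := parseval N (Finset.Ico 0 N) (by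
    intro x hx; simp only [Finset.mem_Ico] at hx; omega) (fun _ => 1)
  have hc : ((Finset.Ico (0 : ℤ) N).card : ℝ) = N := by simp
  calc _ ≤ ∑ r, (N : ℝ) * ‖FT N (Finset.Ico 0 N) (fun _ => 1) r‖ ^ 2 := by
        refine Finset.sum_le_sum fun r _ => ?_
        have := FT_norm_le N (Finset.Ico 0 N) r
        rw [hc] at this
        rw [pow_succ, mul_comm]
        gcongr
    _ = (2 * N + 1) * (N : ℝ) ^ 2 := by
        rw [← Finset.mul_sum, h]
        simp; ring

lemma amgm1 (U V : ℝ) (hU : 0 ≤ U) (hV : 0 ≤ V) :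
    (U + V) ^ 3 - V ^ 3 ≤ 30301 * U ^ 3 + V ^ 3 / 32 := by
  by_cases h : V ≤ 100 * U
  · have h1 : U ^ 2 * V ≤ U ^ 2 * (100 * U) := by gcongr
    have h2 : U * V ^ 2 ≤ U * (100 * U) ^ 2 := by gcongr
    have h3 : 0 ≤ V ^ 3 := by positivity
    nlinarith
  · have h' : U ≤ V / 100 := by linarith
    have h1 : U ^ 2 * V ≤ (V / 100) ^ 2 * V := by gcongr
    have h2 : U * V ^ 2 ≤ (V / 100) * V ^ 2 := by gcongr
    have h3 : 0 ≤ V ^ 3 := by positivity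
    have h4 : 0 ≤ U ^ 3 := by positivity
    nlinarith

lemma amgm (u v u' v' : ℝ) (hu : 0 ≤ u) (hv : 0 ≤ v) (hu' : 0 ≤ u') (hv' : 0 ≤ v') :
    (u + v) ^ 2 * (u' + v') - v ^ 2 * v' ≤
      30301 * (u ^ 3 + u' ^ 3) + (v ^ 3 + v' ^ 3) / 32 := by
  set U := max u u'
  set V := max v v'
  have a1 : u ≤ U := le_max_left _ _
  have a2 : u' ≤ U := le_max_right _ _
  have a3 : v ≤ V := le_max_left _ _
  have a4 : v' ≤ V := le_max_right _ _
  have hU : 0 ≤ U := hu.trans a1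
  have hV : 0 ≤ V := hv.trans a3
  have b1 : U ^ 3 ≤ u ^ 3 + u' ^ 3 := by
    have := pow_nonneg hu 3; have := pow_nonneg hu' 3
    rcases max_choice u u' with h | h <;> simp only [U, h] <;> linarith
  have b2 : V ^ 3 ≤ v ^ 3 + v' ^ 3 := by
    have := pow_nonneg hv 3; have := pow_nonneg hv' 3
    rcases max_choice v v' with h | h <;> simp only [V, h] <;> linarith
  have c1 : u ^ 2 * u' ≤ U ^ 2 * U := by gcongr
  have c2 : u * v * u' ≤ U * V * U := by gcongr
  have c3 : v ^ 2 * u' ≤ V ^ 2 * U := by gcongr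
  have c4 : u ^ 2 * v' ≤ U ^ 2 * V := by gcongr
  have c5 : u * v * v' ≤ U * V * V := by gcongr
  have := amgm1 U V hU hV
  nlinarith

/-- The balanced function. -/
noncomputable def bal (A : Finset ℤ) (a : ℝ) (x : ℤ) : ℝ := (if x ∈ A then 1 else 0) - a

lemma cubic (N : ℕ) (hN : 0 < N) (A : Finset ℤ) (hF : Free A) (a : ℝ)
    (ha : 0 < a) (hc : (A.card : ℝ) = a * N) (hbig : 8 ≤ a ^ 2 * N) :
    (1 / 32 / 30301) * (a * N) ^ 3 ≤ ∑ r, ‖FT N (Finset.Ico 0 N) (bal A a) r‖ ^ 3 := by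
  set I := Finset.Ico (0 : ℤ) N
  set F := FT N I (bal A a)
  set J := FT N I (fun _ => 1)
  have hsplit : ∀ r, FT N I (fun x => if x ∈ A then 1 else 0) r = F r + a * J r := by
    intro r
    simp only [F, J, FT, bal, Finset.mul_sum, ← Finset.sum_add_distrib]
    refine Finset.sum_congr rfl fun x _ => ?_
    push_cast; ring
  have hconst : ∀ r, FT N I (fun _ => a) r = a * J r := by
    intro r
    simp only [J, FT, Finset.mul_sum]
    refine Finset.sum_congr rfl fun x _ => ?_
    push_cast; ring
  have t1 := trilinear N (fun x => if x ∈ A then 1 else 0)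
  have t2 := trilinear N (fun _ => a)
  simp_rw [show Finset.Ico (0 : ℤ) N = I from rfl] at t1 t2
  simp_rw [hsplit] at t1
  simp_rw [hconst] at t2
  have e1 := T_free N A hF
  have e2 := T_one N a ha.le
  set T1 := T N (fun x => if x ∈ A then 1 else 0)
  set T2 := T N (fun _ => a)
  have hd : (2 * N + 1) * (T2 - T1) ≤ ∑ r, ‖(a * J r) * (a * J r) * (a * J (-2 * r))
      - (F r + a * J r) * (F r + a * J r) * (F (-2 * r) + a * J (-2 * r))‖ := by
    have : (∑ r, ((a * J r) * (a * J r) * (a * J (-2 * r))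
      - (F r + a * J r) * (F r + a * J r) * (F (-2 * r) + a * J (-2 * r))))
        = (((2 * N + 1) * (T2 - T1) : ℝ) : ℂ) := by
      rw [Finset.sum_sub_distrib, t1, t2]; push_cast; ring
    refine le_trans ?_ (norm_sum_le _ _)
    rw [this, Complex.norm_real]
    exact Real.le_norm_self _
  have hp : ∀ r, ‖(a * J r) * (a * J r) * (a * J (-2 * r))
      - (F r + a * J r) * (F r + a * J r) * (F (-2 * r) + a * J (-2 * r))‖
      ≤ 30301 * (‖F r‖ ^ 3 + ‖F (-2 * r)‖ ^ 3) +
        a ^ 3 * (‖J r‖ ^ 3 + ‖J (-2 * r)‖ ^ 3) / 32 := by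
    intro r
    have h0 : ∀ x y x' y' : ℂ, ‖y * y * y' - (x + y) * (x + y) * (x' + y')‖ ≤
        (‖x‖ + ‖y‖) ^ 2 * (‖x'‖ + ‖y'‖) - ‖y‖ ^ 2 * ‖y'‖ := by
      intro x y x' y'
      have : y * y * y' - (x + y) * (x + y) * (x' + y') =
        -(x * x * x' + x * x * y' + 2 * (x * y * x') + 2 * (x * y * y') + y * y * x') := by ring
      rw [this, norm_neg]
      have n2 : ‖(2 : ℂ)‖ = 2 := by simp
      have g1 := norm_add_le (x * x * x' + x * x * y' + 2 * (x * y * x') + 2 * (x * y * y'))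
        (y * y * x')
      have g2 := norm_add_le (x * x * x' + x * x * y' + 2 * (x * y * x')) (2 * (x * y * y'))
      have g3 := norm_add_le (x * x * x' + x * x * y') (2 * (x * y * x'))
      have g4 := norm_add_le (x * x * x') (x * x * y')
      simp only [norm_mul, n2] at g1 g2 g3 g4
      nlinarith
    refine (h0 _ _ _ _).trans ((amgm _ _ _ _ (by positivity) (by positivity) (by positivity)
      (by positivity)).trans (le_of_eq ?_))
    simp only [norm_mul, Complex.norm_real, Real.norm_of_nonneg ha.le]
    ring
  have hs := hd.trans (Finset.sum_le_sum fun r _ => hp r)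
  rw [Finset.sum_add_distrib, ← Finset.mul_sum, ← Finset.sum_div, ← Finset.mul_sum,
    Finset.sum_add_distrib, Finset.sum_add_distrib, sum_dilate N (fun r => ‖F r‖ ^ 3),
    sum_dilate N (fun r => ‖J r‖ ^ 3)] at hs
  have hJ : ∑ r, ‖J r‖ ^ 3 ≤ (2 * N + 1) * (N : ℝ) ^ 2 := cubeI N
  set X := ∑ r, ‖F r‖ ^ 3
  set Y := ∑ r, ‖J r‖ ^ 3
  have hN' : (0 : ℝ) < N := by exact_mod_cast hN
  have h3 : a ^ 3 * Y ≤ a ^ 3 * ((2 * N + 1) * (N : ℝ) ^ 2) := by gcongr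
  have h4 : a ^ 3 * ((N : ℝ) ^ 2 / 8) ≤ T2 - T1 := by
    have : 8 * (a * N) ≤ a ^ 2 * N * (a * N) := by gcongr
    rw [hc] at e1
    nlinarith
  have h5 : (2 * N + 1) * (a ^ 3 * ((N : ℝ) ^ 2 / 8)) ≤ (2 * N + 1) * (T2 - T1) := by gcongr
  have h6 : 0 < a ^ 3 * (N : ℝ) ^ 2 := by positivity
  have h7 : 0 < a ^ 3 * (N : ℝ) ^ 3 := by positivity
  have h8 : (2 * N + 1) * (a ^ 3 * ((N : ℝ) ^ 2)) / 16 ≤ 30301 * (2 * X) := by linarith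
  have h9 : (a * N) ^ 3 = a ^ 3 * (N : ℝ) ^ 3 := by ring
  rw [h9]
  nlinarith

lemma extract {ι : Type*} [DecidableEq ι] (v : ι → ℝ) (w : ℕ → ℝ) (S : Finset ι)
    (h : ∑ k ∈ Finset.range S.card, w (k + 1) < ∑ r ∈ S, v r) :
    ∃ R ⊆ S, R.Nonempty ∧ ∀ r ∈ R, w R.card ≤ v r := by
  induction' hn : S.card with n ih generalizing S
  · rw [Finset.card_eq_zero] at hn; subst hn; simp at h
  · have hne : S.Nonempty := by rw [← Finset.card_pos]; omega
    obtain ⟨r0, hr0, hmin⟩ := Finset.exists_min_image S v hne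
    by_cases hc : w S.card ≤ v r0
    · exact ⟨S, subset_rfl, hne, fun r hr => hc.trans (hmin r hr)⟩
    · push Not at hc
      have hcard : (S.erase r0).card = n := by rw [Finset.card_erase_of_mem hr0]; omega
      obtain ⟨R, hR, h1, h2⟩ := ih (S.erase r0) (by
        rw [hn, Finset.sum_range_succ, ← hn] at h
        rw [← Finset.add_sum_erase S v hr0] at h
        rw [hcard]
        linarith) hcard
      exact ⟨R, hR.trans (Finset.erase_subset _ _), h1, h2⟩

lemma spectrum : ∃ c : ℝ, 0 < c ∧ ∀ (N : ℕ) (A : Finset ℤ) (a : ℝ), 0 < N → Free A →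
    0 < a → (A.card : ℝ) = a * N → 8 ≤ a ^ 2 * N →
    ∃ R : Finset (ZMod (2 * N + 1)), R.Nonempty ∧
      c * (a * N) ^ 2 * (R.card : ℝ) ^ (1 / 6 : ℝ) ≤
        ∑ r ∈ R, ‖FT N (Finset.Ico 0 N) (bal A a) r‖ ^ 2 := by
  have hsum : Summable (fun n : ℕ => 1 / ((n : ℝ) ^ (5 / 4 : ℝ))) :=
    Real.summable_one_div_nat_rpow.2 (by norm_num)
  set W := ∑' n : ℕ, 1 / ((n : ℝ) ^ (5 / 4 : ℝ)) with hW
  have hW0 : 0 ≤ W := tsum_nonneg fun n => by positivity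
  set b : ℝ := (1 / 32 / 30301) / (W + 1) with hb
  have hb0 : 0 < b := by positivity
  refine ⟨b ^ (2 / 3 : ℝ), by positivity, ?_⟩
  intro N A a hN hF ha hc hbig
  have hcub := cubic N hN A hF a ha hc hbig
  set F := FT N (Finset.Ico 0 N) (bal A a)
  have hN' : (0 : ℝ) < N := by exact_mod_cast hN
  have haN : 0 < a * N := by positivity
  obtain ⟨R, -, hR, hRv⟩ := extract (fun r => ‖F r‖ ^ 3)
    (fun k => b * (a * N) ^ 3 * (1 / ((k : ℝ) ^ (5 / 4 : ℝ)))) Finset.univ (by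
      refine lt_of_lt_of_le ?_ hcub
      rw [← Finset.mul_sum]
      have h1 : ∑ k ∈ Finset.range (Finset.univ : Finset (ZMod (2 * N + 1))).card,
          1 / (((k + 1 : ℕ) : ℝ) ^ (5 / 4 : ℝ)) ≤ W := by
        rw [← Finset.sum_image (s := Finset.range _) (g := fun k => k + 1)
          (f := fun n : ℕ => 1 / ((n : ℝ) ^ (5 / 4 : ℝ))) (by intro x _ y _ h; simpa using h)]
        exact hsum.sum_le_tsum _ (fun n _ => by positivity)
      calc _ ≤ b * (a * N) ^ 3 * W := by gcongr
        _ < b * (a * N) ^ 3 * (W + 1) := by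
            have : 0 < b * (a * N) ^ 3 := by positivity
            nlinarith
        _ = _ := by rw [hb]; field_simp)
  refine ⟨R, hR, ?_⟩
  set k : ℝ := (R.card : ℝ) with hk
  have hk0 : 0 < k := by rw [hk]; exact_mod_cast hR.card_pos
  have hpt : ∀ r ∈ R, b ^ (2 / 3 : ℝ) * (a * N) ^ 2 * (k ^ (5 / 6 : ℝ))⁻¹ ≤ ‖F r‖ ^ 2 := by
    intro r hr
    have h := hRv r hr
    have h2 := Real.rpow_le_rpow (by positivity) h (show (0 : ℝ) ≤ 2 / 3 by norm_num)
    have e1 : (‖F r‖ ^ 3) ^ (2 / 3 : ℝ) = ‖F r‖ ^ 2 := by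
      rw [← Real.rpow_natCast, ← Real.rpow_mul (norm_nonneg _), ← Real.rpow_natCast]
      norm_num
    have e2 : ((a * N) ^ 3) ^ (2 / 3 : ℝ) = (a * N) ^ 2 := by
      rw [← Real.rpow_natCast, ← Real.rpow_mul haN.le, ← Real.rpow_natCast]
      norm_num
    have e3 : (1 / (k ^ (5 / 4 : ℝ))) ^ (2 / 3 : ℝ) = (k ^ (5 / 6 : ℝ))⁻¹ := by
      rw [one_div, Real.inv_rpow (by positivity), ← Real.rpow_mul hk0.le]
      norm_num
    simp only [e1] at h2
    rw [Real.mul_rpow (by positivity) (by positivity), Real.mul_rpow (by positivity)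
      (by positivity), e2, e3] at h2
    exact h2
  have := Finset.card_nsmul_le_sum R _ _ hpt
  refine le_trans (le_of_eq ?_) this
  rw [nsmul_eq_mul, ← hk]
  have e4 : k = k ^ (1 / 6 : ℝ) * k ^ (5 / 6 : ℝ) := by
    rw [← Real.rpow_add hk0]; norm_num
  have : 0 < k ^ (5 / 6 : ℝ) := by positivity
  nth_rewrite 2 [e4]
  field_simp

end HB
namespace HB

lemma char_exp (N : ℕ) (a : ZMod (2 * N + 1)) :
    (ZMod.stdAddChar a : ℂ) =
      Complex.exp (Complex.I * ((2 * Real.pi * (a.val / (2 * N + 1 : ℝ)) : ℝ) : ℂ)) := by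
  rw [ZMod.stdAddChar_apply, ZMod.toCircle_apply]
  congr 1
  push_cast
  ring

lemma dirichlet (N : ℕ) (R : Finset (ZMod (2 * N + 1))) (m : ℕ) (hm : 0 < m) :
    ∃ q : ℕ, 1 ≤ q ∧ q ≤ m ^ R.card ∧
      ∀ r ∈ R, ‖(ZMod.stdAddChar (r * (q : ZMod (2 * N + 1))) : ℂ) - 1‖ ≤ 2 * Real.pi / m := by
  have hn : (0 : ℝ) < 2 * N + 1 := by positivity
  have hm' : (0 : ℝ) < m := by exact_mod_cast hm
  have hθ1 : ∀ a : ZMod (2 * N + 1), (a.val : ℝ) / (2 * N + 1) < 1 := by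
    intro a
    rw [div_lt_one hn]
    exact_mod_cast ZMod.val_lt a
  have hθ0 : ∀ a : ZMod (2 * N + 1), 0 ≤ (a.val : ℝ) / (2 * N + 1) := fun a => by positivity
  let g : Fin (m ^ R.card + 1) → (R → Fin m) := fun j r =>
    ⟨⌊(m : ℝ) * (((r : ZMod (2 * N + 1)) * ((j : ℕ) : ZMod (2 * N + 1))).val / (2 * N + 1 : ℝ))⌋₊,
      by
        rw [Nat.floor_lt (mul_nonneg hm'.le (hθ0 _))]
        have := hθ1 ((r : ZMod (2 * N + 1)) * ((j : ℕ) : ZMod (2 * N + 1)))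
        nlinarith⟩
  obtain ⟨i, j, hij, hg⟩ := Fintype.exists_ne_map_eq_of_card_lt g (by simp)
  have key : ∀ i j : Fin (m ^ R.card + 1), i < j → g i = g j → ∃ q : ℕ, 1 ≤ q ∧ q ≤ m ^ R.card ∧
      ∀ r ∈ R, ‖(ZMod.stdAddChar (r * (q : ZMod (2 * N + 1))) : ℂ) - 1‖ ≤ 2 * Real.pi / m := by
    intro i j hij hg
    have hlt : (i : ℕ) < j := hij
    refine ⟨j - i, by omega, by omega, ?_⟩
    intro r hr
    have h1 := congrFun hg ⟨r, hr⟩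
    simp only [g, Fin.mk.injEq] at h1
    set s := r * ((i : ℕ) : ZMod (2 * N + 1))
    set t := r * ((j : ℕ) : ZMod (2 * N + 1))
    have e0 : r * ((j - i : ℕ) : ZMod (2 * N + 1)) + s = t := by
      rw [Nat.cast_sub hlt.le]; simp only [s, t]; ring
    have e1 : (ZMod.stdAddChar (r * ((j - i : ℕ) : ZMod (2 * N + 1))) : ℂ) * ZMod.stdAddChar s
        = ZMod.stdAddChar t := by
      rw [← AddChar.map_add_eq_mul, e0]
    have hs : ∀ x : ZMod (2 * N + 1), (⌊(m : ℝ) * (x.val / (2 * N + 1 : ℝ))⌋₊ : ℝ) ≤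
        (m : ℝ) * (x.val / (2 * N + 1 : ℝ)) ∧ (m : ℝ) * (x.val / (2 * N + 1 : ℝ)) <
        (⌊(m : ℝ) * (x.val / (2 * N + 1 : ℝ))⌋₊ : ℝ) + 1 := fun x =>
      ⟨Nat.floor_le (mul_nonneg hm'.le (hθ0 _)), Nat.lt_floor_add_one _⟩
    have h2 := hs s
    have h3 := hs t
    rw [h1] at h2
    set θs := (s.val / (2 * N + 1 : ℝ))
    set θt := (t.val / (2 * N + 1 : ℝ))
    have h4 : |θt - θs| ≤ 1 / m := by
      rw [le_div_iff₀ hm', ← abs_of_pos hm', ← abs_mul, abs_le]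
      constructor <;> nlinarith
    have e2 : (ZMod.stdAddChar (r * ((j - i : ℕ) : ZMod (2 * N + 1))) : ℂ) =
        Complex.exp (Complex.I * ((2 * Real.pi * (θt - θs) : ℝ) : ℂ)) := by
      have h5 : (ZMod.stdAddChar s : ℂ) ≠ 0 := by
        intro h; have := norm_char N s; rw [h] at this; simp at this
      apply mul_right_cancel₀ h5
      rw [e1, char_exp N s, char_exp N t, ← Complex.exp_add]
      congr 1
      simp only [θs, θt]
      push_cast
      ring
    rw [e2]
    refine Real.norm_exp_I_mul_ofReal_sub_one_le.trans ?_
    rw [Real.norm_eq_abs, abs_mul, abs_of_pos Real.two_pi_pos]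
    calc 2 * Real.pi * |θt - θs| ≤ 2 * Real.pi * (1 / m) := by gcongr
      _ = _ := by ring
  rcases lt_or_gt_of_ne hij with h | h
  · exact key i j h hg
  · exact key j i h hg.symm

lemma geom (z : ℂ) (L : ℕ) (hz : ‖z‖ = 1) (h : ‖z - 1‖ * L ≤ 1 / 2) :
    (L : ℝ) / 2 ≤ ‖∑ j ∈ Finset.range L, z ^ j‖ := by
  have hp : ∀ j : ℕ, ‖z ^ j - 1‖ ≤ j * ‖z - 1‖ := by
    intro j
    induction' j with j ih
    · simp
    · have : z ^ (j + 1) - 1 = z * (z ^ j - 1) + (z - 1) := by ring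
      rw [this]
      refine (norm_add_le _ _).trans ?_
      rw [norm_mul, hz]; push_cast; linarith
  have h1 : ‖∑ j ∈ Finset.range L, (z ^ j - 1)‖ ≤ L * (1 / 2) := by
    refine (norm_sum_le _ _).trans ?_
    have : ∀ j ∈ Finset.range L, ‖z ^ j - 1‖ ≤ 1 / 2 := by
      intro j hj
      refine (hp j).trans (le_trans ?_ h)
      rw [mul_comm]
      gcongr
      exact (Finset.mem_range.1 hj).le
    have := Finset.sum_le_card_nsmul _ _ _ this
    simpa using this
  rw [Finset.sum_sub_distrib] at h1
  simp only [Finset.sum_const, Finset.card_range, nsmul_eq_mul, mul_one] at h1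
  have h2 := norm_sub_norm_le (L : ℂ) (∑ j ∈ Finset.range L, z ^ j)
  rw [norm_sub_rev] at h2
  simp only [Complex.norm_natCast] at h2
  linarith

/-- Averaged balanced function along progressions. -/
noncomputable def Gf (N L q : ℕ) (f : ℤ → ℝ) (x : ℤ) : ℝ :=
  ∑ j ∈ Finset.range L, if x + q * j ∈ Finset.Ico (0 : ℤ) N then f (x + q * j) else 0

lemma FT_G (N L q : ℕ) (f : ℤ → ℝ) (h : L * q ≤ N) (r : ZMod (2 * N + 1)) :
    FT N (Finset.Icc (-(N : ℤ)) N) (Gf N L q f) r =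
      FT N (Finset.Ico 0 N) f r *
        ∑ j ∈ Finset.range L, (ZMod.stdAddChar (-(r * (q : ZMod (2 * N + 1)))) : ℂ) ^ j := by
  simp only [FT, Gf, Complex.ofReal_sum, Finset.sum_mul]
  rw [Finset.sum_comm]
  simp only [Finset.mul_sum]
  rw [Finset.sum_comm (s := Finset.Ico (0 : ℤ) N)]
  refine Finset.sum_congr rfl fun j hj => ?_
  have hj' : q * j ≤ N := by
    have := Finset.mem_range.1 hj
    nlinarith
  have e1 : ∀ x : ℤ, (((if x + q * j ∈ Finset.Ico (0 : ℤ) N then f (x + q * j) else 0 : ℝ) : ℂ) *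
      ZMod.stdAddChar (r * (x : ZMod (2 * N + 1)))) =
      if x + q * j ∈ Finset.Ico (0 : ℤ) N then ((f (x + q * j) : ℂ) *
        ZMod.stdAddChar (r * (x : ZMod (2 * N + 1)))) else 0 := by
    intro x; split_ifs <;> simp
  simp_rw [e1]
  rw [← Finset.sum_filter]
  have hj'' : (q : ℤ) * j ≤ N := by exact_mod_cast hj'
  have hj0 : 0 ≤ (q : ℤ) * j := by positivity
  refine Finset.sum_nbij' (fun x => x + q * j) (fun y => y - q * j) ?_ ?_ ?_ ?_ ?_
  · intro x hx; exact (Finset.mem_filter.1 hx).2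
  · intro y hy
    simp only [Finset.mem_filter, Finset.mem_Icc, Finset.mem_Ico] at hy ⊢
    constructor <;> constructor <;> linarith
  · intro x _; ring
  · intro y _; ring
  · intro x _
    rw [mul_assoc]
    congr 1
    rw [← AddChar.map_nsmul_eq_pow, ← AddChar.map_add_eq_mul]
    congr 1
    push_cast
    rw [nsmul_eq_mul]
    ring

lemma energy (N L : ℕ) (f : ℤ → ℝ) (R : Finset (ZMod (2 * N + 1))) (q : ℕ) (h : L * q ≤ N)
    (hL : 1 ≤ L)
    (hq : ∀ r ∈ R, ‖(ZMod.stdAddChar (r * (q : ZMod (2 * N + 1))) : ℂ) - 1‖ ≤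
      2 * Real.pi / (16 * L : ℕ)) :
    (L : ℝ) ^ 2 / 4 * ∑ r ∈ R, ‖FT N (Finset.Ico 0 N) f r‖ ^ 2 ≤
      (2 * N + 1) * ∑ x ∈ Finset.Icc (-(N : ℤ)) N, Gf N L q f x ^ 2 := by
  rw [← parseval N _ (by intro x hx; simpa using hx)]
  refine le_trans ?_ (Finset.sum_le_univ_sum_of_nonneg (s := R) fun r => by positivity)
  rw [Finset.mul_sum]
  refine Finset.sum_le_sum fun r hr => ?_
  rw [FT_G N L q f h r, norm_mul, mul_pow, mul_comm]
  have hL' : (0 : ℝ) < L := by exact_mod_cast hL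
  have hg := geom (ZMod.stdAddChar (-(r * (q : ZMod (2 * N + 1)))) : ℂ) L (norm_char _ _) (by
    have e : ‖(ZMod.stdAddChar (-(r * (q : ZMod (2 * N + 1)))) : ℂ) - 1‖ =
        ‖(ZMod.stdAddChar (r * (q : ZMod (2 * N + 1))) : ℂ) - 1‖ := by
      rw [← conj_char, ← Complex.norm_conj]; simp
    rw [e]
    calc _ ≤ 2 * Real.pi / (16 * L : ℕ) * L := by gcongr; exact hq r hr
      _ = Real.pi / 8 := by push_cast; field_simp; norm_num
      _ ≤ 1 / 2 := by have := Real.pi_le_four; linarith)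
  have : (L : ℝ) ^ 2 / 4 ≤ ‖∑ j ∈ Finset.range L,
      (ZMod.stdAddChar (-(r * (q : ZMod (2 * N + 1)))) : ℂ) ^ j‖ ^ 2 := by
    calc (L : ℝ) ^ 2 / 4 = ((L : ℝ) / 2) ^ 2 := by ring
      _ ≤ _ := by gcongr
  gcongr

lemma bal_sum (N : ℕ) (A : Finset ℤ) (hA : A ⊆ Finset.Ico 0 (N : ℤ)) (a : ℝ)
    (hc : (A.card : ℝ) = a * N) : ∑ x ∈ Finset.Ico (0 : ℤ) N, bal A a x = 0 := by
  simp only [bal, Finset.sum_sub_distrib]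
  rw [← Finset.sum_filter, Finset.filter_mem_eq_inter, Finset.inter_eq_right.2 hA]
  simp [hc]; ring

lemma bal_sq (N : ℕ) (A : Finset ℤ) (hA : A ⊆ Finset.Ico 0 (N : ℤ)) (a : ℝ)
    (hc : (A.card : ℝ) = a * N) : ∑ x ∈ Finset.Ico (0 : ℤ) N, bal A a x ^ 2 ≤ a * N := by
  have e : ∀ x, bal A a x ^ 2 = (1 - 2 * a) * bal A a x + (a - a ^ 2) := by
    intro x; unfold bal; split_ifs <;> ring
  simp_rw [e]
  rw [Finset.sum_add_distrib, ← Finset.mul_sum, bal_sum N A hA a hc]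
  simp
  nlinarith [sq_nonneg a, Nat.cast_nonneg (α := ℝ) N, mul_nonneg (sq_nonneg a) (Nat.cast_nonneg (α := ℝ) N)]

lemma upper (N L q : ℕ) (A : Finset ℤ) (hA : A ⊆ Finset.Ico 0 (N : ℤ)) (a b : ℝ)
    (ha : 0 < a) (ha1 : a ≤ 1) (hb : 0 ≤ b) (hN : 0 < N) (hLq : L * q ≤ N)
    (hc : (A.card : ℝ) = a * N)
    (hno : ∀ x : ℤ, (((Finset.range L).filter (fun j : ℕ => x + q * j ∈ A)).card : ℝ) ≤
      a * (1 + b) * L) :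
    ∑ x ∈ Finset.Icc (-(N : ℤ)) N, Gf N L q (bal A a) x ^ 2 ≤
      3 * b * a ^ 2 * L ^ 2 * N + 4 * a * L ^ 2 * (L * q) := by
  set G := Gf N L q (bal A a) with hG
  set S := Finset.Icc (-(N : ℤ)) N with hS
  have hN' : (1 : ℝ) ≤ N := by exact_mod_cast hN
  have hsum : ∑ x ∈ S, G x = 0 := by
    have h := FT_G N L q (bal A a) hLq 0
    have h1 : FT N (Finset.Ico 0 N) (bal A a) 0 = 0 := by
      have := bal_sum N A hA a hc
      simp only [FT, zero_mul, AddChar.map_zero_eq_one, mul_one]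
      exact_mod_cast this
    rw [h1, zero_mul] at h
    simp only [FT, zero_mul, AddChar.map_zero_eq_one, mul_one] at h
    exact_mod_cast h
  set B := Finset.Ico (-((L * q : ℕ) : ℤ)) 0 ∪ Finset.Ico ((N : ℤ) - (L * q : ℕ)) N with hB
  have hBc : (B.card : ℝ) ≤ 2 * (L * q) := by
    have := Finset.card_union_le (Finset.Ico (-((L * q : ℕ) : ℤ)) 0)
      (Finset.Ico ((N : ℤ) - (L * q : ℕ)) N)
    rw [← hB] at this
    simp only [Int.card_Ico, sub_neg_eq_add, zero_add, sub_sub_cancel, Int.toNat_natCast] at this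
    have h2 : B.card ≤ 2 * (L * q) := by omega
    exact_mod_cast h2
  have hpt : ∀ x : ℤ, G x ^ 2 + (1 - b) * a * L * G x - b * a ^ 2 * L ^ 2 ≤
      if x ∈ B then 2 * a * L ^ 2 else 0 := by
    intro x
    set n1 : ℝ := (((Finset.range L).filter (fun j : ℕ => x + q * j ∈ A)).card : ℝ) with hn1
    set n2 : ℝ := (((Finset.range L).filter
      (fun j : ℕ => x + q * j ∈ Finset.Ico (0 : ℤ) N)).card : ℝ) with hn2
    have h12 : n1 ≤ n2 := by
      rw [hn1, hn2]
      exact_mod_cast Finset.card_le_card (Finset.monotone_filter_right _ fun j _ hj => hA hj)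
    have h2L : n2 ≤ L := by
      rw [hn2]
      have := Finset.card_filter_le (Finset.range L)
        (fun j : ℕ => x + q * j ∈ Finset.Ico (0 : ℤ) N)
      rw [Finset.card_range] at this
      exact_mod_cast this
    have h10 : 0 ≤ n1 := Nat.cast_nonneg _
    have hGx : G x = n1 - a * n2 := by
      rw [hG, Gf, hn1, hn2, Finset.card_filter, Finset.card_filter]
      push_cast
      rw [Finset.mul_sum, ← Finset.sum_sub_distrib]
      refine Finset.sum_congr rfl fun j _ => ?_
      by_cases h : x + (q : ℤ) * j ∈ Finset.Ico (0 : ℤ) N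
      · rw [if_pos h, if_pos h, bal]; simp
      · rw [if_neg h, if_neg h, if_neg (fun h' => h (hA h'))]; simp
    have hno' := hno x
    rw [← hn1] at hno'
    have hL0 : (0 : ℝ) ≤ L := Nat.cast_nonneg _
    have hfac : G x ^ 2 + (1 - b) * a * L * G x - b * a ^ 2 * L ^ 2 =
      (G x + a * L) * (G x - b * a * L) := by ring
    have hg0 : 0 ≤ G x + a * L := by rw [hGx]; nlinarith
    rw [hfac]
    split_ifs with hx
    · by_cases hs : G x - b * a * L ≤ 0
      · have : 0 ≤ 2 * a * (L : ℝ) ^ 2 := by positivity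
        nlinarith
      · push Not at hs
        have u1 : G x + a * L ≤ 2 * L := by rw [hGx]; nlinarith
        have u2 : G x - b * a * L ≤ a * L := by rw [hGx]; nlinarith
        calc _ ≤ (2 * (L : ℝ)) * (a * L) := by gcongr
          _ = _ := by ring
    · simp only [hB, Finset.mem_union, Finset.mem_Ico, not_or, not_and, not_lt] at hx
      have hjq : ∀ j ∈ Finset.range L, 0 ≤ (q : ℤ) * j ∧ (q : ℤ) * j ≤ (L * q : ℕ) := by
        intro j hj
        refine ⟨by positivity, ?_⟩
        have := Finset.mem_range.1 hj
        have h3 : q * j ≤ L * q := by nlinarith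
        exact_mod_cast h3
      by_cases hin : 0 ≤ x ∧ x < (N : ℤ) - (L * q : ℕ)
      · have : n2 = L := by
          rw [hn2, Finset.filter_true_of_mem, Finset.card_range]
          intro j hj
          have := hjq j hj
          rw [Finset.mem_Ico]
          omega
        have : G x - b * a * L ≤ 0 := by rw [hGx, this]; nlinarith
        nlinarith
      · have : n2 = 0 := by
          rw [hn2, Finset.filter_false_of_mem]
          · simp
          intro j hj
          have := hjq j hj
          rw [Finset.mem_Ico]
          omega
        have hz : G x = 0 := by rw [hGx, this]; nlinarith
        rw [hz]
        have : 0 ≤ a * L * (b * a * L) := by positivity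
        nlinarith
  have hs := Finset.sum_le_sum fun x (_ : x ∈ S) => hpt x
  rw [Finset.sum_sub_distrib, Finset.sum_add_distrib, ← Finset.mul_sum, hsum, mul_zero, add_zero,
    Finset.sum_const, nsmul_eq_mul] at hs
  have hS3 : (S.card : ℝ) ≤ 3 * N := by
    have : S.card = 2 * N + 1 := by rw [hS, Int.card_Icc]; omega
    rw [this]; push_cast; linarith
  have hr : ∑ x ∈ S, (if x ∈ B then 2 * a * (L : ℝ) ^ 2 else 0) ≤ 2 * (L * q) * (2 * a * L ^ 2) := by
    rw [← Finset.sum_filter, Finset.sum_const, nsmul_eq_mul]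
    have : ((S.filter (· ∈ B)).card : ℝ) ≤ B.card := by
      exact_mod_cast Finset.card_le_card (fun x hx => (Finset.mem_filter.1 hx).2)
    have := this.trans hBc
    gcongr
  have h5 : (S.card : ℝ) * (b * a ^ 2 * L ^ 2) ≤ 3 * N * (b * a ^ 2 * L ^ 2) := by gcongr
  linarith

lemma increment : ∃ c η : ℝ, 0 < c ∧ 0 < η ∧ ∀ (N : ℕ) (A : Finset ℤ) (a : ℝ), 0 < N →
    A ⊆ Finset.Ico 0 (N : ℤ) → Free A →
    0 < a → (A.card : ℝ) = a * N → 8 ≤ a ^ 2 * N →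
    ∃ k : ℕ, 1 ≤ k ∧ c * a * (k : ℝ) ^ (1 / 6 : ℝ) ≤ 1 ∧
      ∀ L : ℕ, 1 ≤ L → (16 * L : ℝ) ^ (k + 1) ≤ η * a * N →
        ∃ (x : ℤ) (q : ℕ), 0 < q ∧ a * (1 + c * (k : ℝ) ^ (1 / 6 : ℝ)) * L ≤
          (((Finset.range L).filter (fun j : ℕ => x + q * j ∈ A)).card : ℝ) := by
  obtain ⟨c, hc0, hspec⟩ := spectrum
  refine ⟨c / 72, min 1 (c / 192), by positivity, by positivity, ?_⟩
  intro N A a hN hA hF ha hc hbig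
  obtain ⟨R, hR, hsum⟩ := hspec N A a hN hF ha hc hbig
  have hN' : (1 : ℝ) ≤ N := by exact_mod_cast hN
  have ha1 : a ≤ 1 := by
    have := Finset.card_le_card hA
    simp only [Int.card_Ico, sub_zero, Int.toNat_natCast] at this
    have h2 : (A.card : ℝ) ≤ N := by exact_mod_cast this
    rw [hc] at h2
    nlinarith
  refine ⟨R.card, hR.card_pos, ?_, ?_⟩
  · have h1 : ∑ r ∈ R, ‖FT N (Finset.Ico 0 N) (bal A a) r‖ ^ 2 ≤ (2 * N + 1) * (a * N) := by
      refine (Finset.sum_le_univ_sum_of_nonneg (s := R) fun r => by positivity).trans ?_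
      rw [parseval N _ (by intro x hx; simp only [Finset.mem_Ico] at hx; omega)]
      gcongr
      exact bal_sq N A hA a hc
    have h2 := hsum.trans h1
    set t := (R.card : ℝ) ^ (1 / 6 : ℝ)
    have h3 : (c * a * t) * (a * (N : ℝ) ^ 2) ≤ 3 * (a * (N : ℝ) ^ 2) := by
      have : a * N * 1 ≤ a * N * N := by gcongr
      nlinarith
    have h4 : c * a * t ≤ 3 := le_of_mul_le_mul_right h3 (by positivity)
    linarith
  · intro L hL hLk
    obtain ⟨q, hq1, hq2, hq⟩ := dirichlet N R (16 * L) (by omega)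
    by_contra hcon
    push Not at hcon
    have hL' : (1 : ℝ) ≤ L := by exact_mod_cast hL
    have hLq : (L : ℝ) * q ≤ min 1 (c / 192) * a * N := by
      refine le_trans ?_ hLk
      have : (q : ℝ) ≤ (16 * L : ℝ) ^ R.card := by exact_mod_cast hq2
      rw [pow_succ, mul_comm]
      have h16 : (L : ℝ) ≤ 16 * L := by linarith
      gcongr
    have hLqN : L * q ≤ N := by
      have : (L : ℝ) * q ≤ N := by
        refine hLq.trans ?_
        calc min 1 (c / 192) * a * N ≤ 1 * 1 * N := by
              gcongr; exact min_le_left _ _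
          _ = N := by ring
      exact_mod_cast this
    have hLqη : (L : ℝ) * q ≤ c / 192 * a * N := by
      refine hLq.trans ?_
      gcongr; exact min_le_right _ _
    have hlow := energy N L (bal A a) R q hLqN hL hq
    have hup := upper N L q A hA a (c / 72 * (R.card : ℝ) ^ (1 / 6 : ℝ)) ha ha1 (by positivity) hN
      hLqN hc (fun x => (hcon x q hq1).le)
    set t := (R.card : ℝ) ^ (1 / 6 : ℝ) with ht
    have ht1 : 1 ≤ t := Real.one_le_rpow (by exact_mod_cast hR.card_pos) (by norm_num)
    set E := ∑ x ∈ Finset.Icc (-(N : ℤ)) N, Gf N L q (bal A a) x ^ 2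
    have hE0 : 0 ≤ E := Finset.sum_nonneg fun x _ => by positivity
    have h1 : (L : ℝ) ^ 2 / 4 * (c * (a * N) ^ 2 * t) ≤ 3 * N * E := by
      calc _ ≤ (L : ℝ) ^ 2 / 4 * ∑ r ∈ R, ‖FT N (Finset.Ico 0 N) (bal A a) r‖ ^ 2 := by gcongr
        _ ≤ (2 * N + 1) * E := hlow
        _ ≤ 3 * N * E := by gcongr; linarith
    have h2 : 4 * a * (L : ℝ) ^ 2 * (L * q) ≤ 4 * a * (L : ℝ) ^ 2 * (c / 192 * a * N) := by gcongr
    set X := a ^ 2 * (L : ℝ) ^ 2 * N with hX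
    have hX0 : 0 < X := by positivity
    have h3 : E ≤ c / 24 * t * X + c / 48 * X := by
      rw [hX]; linarith
    have h4 : c * t * X / 12 ≤ E := by
      have : N * (c * t * X / 12) ≤ N * E := by rw [hX]; linarith
      exact le_of_mul_le_mul_left this (by positivity)
    have h5 : c * 1 * X ≤ c * t * X := by gcongr
    have h6 : 0 < c * X := by positivity
    linarith

end HB
namespace HB

lemma choose_D (c : ℝ) (hc : 0 < c) : ∃ D : ℕ, 6 ≤ D ∧ ∀ k : ℕ, 1 ≤ k →
    4 * ((k : ℝ) + 1) ≤ (1 + c * (k : ℝ) ^ (1 / 6 : ℝ)) ^ D := by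
  obtain ⟨n, hn⟩ := pow_unbounded_of_one_lt (8 / c ^ 6) (show 1 < 1 + c by linarith)
  refine ⟨n + 6, by omega, ?_⟩
  intro k hk
  have hk' : (1 : ℝ) ≤ k := by exact_mod_cast hk
  set t := (k : ℝ) ^ (1 / 6 : ℝ) with ht
  have ht1 : 1 ≤ t := Real.one_le_rpow hk' (by norm_num)
  have ht6 : t ^ 6 = k := by
    rw [ht, ← Real.rpow_natCast, ← Real.rpow_mul (by positivity)]; norm_num
  have h1 : (8 / c ^ 6) * (c * t) ^ 6 ≤ (1 + c * t) ^ n * (1 + c * t) ^ 6 := by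
    have : (1 + c) ^ n ≤ (1 + c * t) ^ n := by
      gcongr
      nlinarith
    have h2 : c * t ≤ 1 + c * t := by linarith
    have h3 := hn.le.trans this
    gcongr
  have h2 : (8 / c ^ 6) * (c * t) ^ 6 = 8 * k := by
    rw [mul_pow, ht6]; field_simp
  rw [pow_add]
  linarith

set_option maxHeartbeats 2000000 in
lemma main_bound : ∃ (K : ℝ) (D : ℕ), 0 < K ∧ 6 ≤ D ∧ ∀ (N : ℕ) (A : Finset ℤ),
    A ⊆ Finset.Ico 0 (N : ℤ) → A.Nonempty → Free A →
    Real.log N ≤ K * ((N : ℝ) / A.card) ^ D := by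
  obtain ⟨c, η, hc, hη, hinc⟩ := increment
  obtain ⟨D, hD6, hD⟩ := choose_D c hc
  set K : ℝ := 8 + 1 / η ^ 2 + 256 / c ^ 6 with hK
  have hK8 : 8 ≤ K ∧ 1 / η ^ 2 ≤ K ∧ 256 / c ^ 6 ≤ K := by
    have h1 : 0 < 1 / η ^ 2 := by positivity
    have h2 : 0 < 256 / c ^ 6 := by positivity
    rw [hK]; refine ⟨?_, ?_, ?_⟩ <;> linarith
  clear_value K
  clear hK
  obtain ⟨hK8, hKη, hKc⟩ := hK8
  have hK0 : 0 < K := by linarith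
  refine ⟨K, D, hK0, hD6, ?_⟩
  intro N
  induction' N using Nat.strong_induction_on with N ih
  intro A hA hne hF
  have hcard : 0 < A.card := hne.card_pos
  have hcN : A.card ≤ N := by
    have := Finset.card_le_card hA
    simpa using this
  have hN : 0 < N := by omega
  have hN' : (1 : ℝ) ≤ N := by exact_mod_cast hN
  have hcard' : (0 : ℝ) < A.card := by exact_mod_cast hcard
  set a : ℝ := A.card / N with ha
  clear_value a
  have ha0 : 0 < a := by rw [ha]; positivity
  have ha1 : a ≤ 1 := by
    rw [ha, div_le_one (by positivity)]; exact_mod_cast hcN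
  have hinv : (N : ℝ) / A.card = a⁻¹ := by rw [ha, inv_div]
  have hi1 : 1 ≤ a⁻¹ := (one_le_inv₀ ha0).2 ha1
  rw [hinv]
  by_cases hsmall : Real.log N ≤ K * a⁻¹ ^ 6
  · refine hsmall.trans ?_
    gcongr
  push Not at hsmall
  have hlogN : Real.log N ≤ N := (Real.log_le_sub_one_of_pos (by positivity)).trans (by linarith)
  have hcA : (A.card : ℝ) = a * N := by rw [ha]; field_simp
  have hp26 : a⁻¹ ^ 2 ≤ a⁻¹ ^ 6 := pow_le_pow_right₀ hi1 (by norm_num)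
  have hNK : K * a⁻¹ ^ 2 ≤ N := by
    have : K * a⁻¹ ^ 2 ≤ K * a⁻¹ ^ 6 := by gcongr
    linarith
  have hNK' : K ≤ a ^ 2 * N := by
    have : a ^ 2 * (K * a⁻¹ ^ 2) ≤ a ^ 2 * N := by gcongr
    refine le_trans (le_of_eq ?_) this
    field_simp
  have hη2 : 0 < 1 / η ^ 2 := by positivity
  have hc6 : 0 < 256 / c ^ 6 := by positivity
  obtain ⟨k, hk1, hka, hL⟩ := hinc N A a hN hA hF ha0 hcA (by linarith)
  have hk' : (1 : ℝ) ≤ k := by exact_mod_cast hk1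
  set t := (k : ℝ) ^ (1 / 6 : ℝ) with ht
  clear_value t
  have ht0 : 0 < t := by rw [ht]; positivity
  have ht6 : t ^ 6 = k := by
    rw [ht, ← Real.rpow_natCast, ← Real.rpow_mul (by positivity)]; norm_num
  have hk6 : (k : ℝ) ≤ 1 / c ^ 6 * a⁻¹ ^ 6 := by
    have : (c * a * t) ^ 6 ≤ 1 := pow_le_one₀ (by positivity) hka
    rw [mul_pow, mul_pow, ht6] at this
    rw [inv_pow, ← div_eq_mul_inv, div_div, le_div_iff₀ (by positivity)]
    linarith
  -- choose the new length
  set Y := Real.exp (Real.log N / (4 * (k + 1))) with hY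
  clear_value Y
  have hYlog : 32 ≤ Y := by
    have h1 : (31 : ℝ) ≤ Real.log N / (4 * (k + 1)) := by
      rw [le_div_iff₀ (by positivity)]
      have : 256 / c ^ 6 * a⁻¹ ^ 6 ≤ K * a⁻¹ ^ 6 := by
        gcongr
      have e : 256 / c ^ 6 * a⁻¹ ^ 6 = 256 * (1 / c ^ 6 * a⁻¹ ^ 6) := by ring
      nlinarith
    have := Real.add_one_le_exp (Real.log N / (4 * (k + 1)))
    rw [hY]; linarith
  set L := ⌊Y ^ 2 / 16⌋₊ with hLdef
  clear_value L
  have hL1 : (L : ℝ) ≤ Y ^ 2 / 16 := by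
    rw [hLdef]; exact Nat.floor_le (by positivity)
  have hL2 : Y ≤ L := by
    have := Nat.lt_floor_add_one (Y ^ 2 / 16)
    rw [← hLdef] at this
    nlinarith
  have hLpos : 1 ≤ L := by
    have : (1 : ℝ) ≤ L := by linarith
    exact_mod_cast this
  have hpow : (Y ^ 2) ^ (k + 1) = Real.sqrt N := by
    rw [← pow_mul, hY, ← Real.exp_nat_mul, Real.sqrt_eq_rpow, Real.rpow_def_of_pos (by positivity)]
    congr 1
    push_cast
    field_simp
    ring
  have hLk : (16 * L : ℝ) ^ (k + 1) ≤ Real.sqrt N := by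
    rw [← hpow]
    gcongr
    linarith
  have hsq : Real.sqrt N * Real.sqrt N = N := Real.mul_self_sqrt (by positivity)
  have hsq1 : 1 ≤ Real.sqrt N := Real.one_le_sqrt.2 hN'
  have hsqη : Real.sqrt N ≤ η * a * N := by
    have h1 : 1 ≤ (η * a * Real.sqrt N) ^ 2 := by
      have : 1 / η ^ 2 ≤ a ^ 2 * N := by linarith
      rw [div_le_iff₀ (by positivity)] at this
      rw [mul_pow, Real.sq_sqrt (by positivity)]
      linarith
    have h2 : 1 ≤ η * a * Real.sqrt N := by
      by_contra h
      push Not at h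
      have := pow_lt_one₀ (by positivity) h (n := 2) (by norm_num)
      linarith
    nlinarith
  obtain ⟨x, q, hq, hdens⟩ := hL L hLpos (hLk.trans hsqη)
  have hLN : L < N := by
    have h1 : (16 * L : ℝ) ≤ (16 * L : ℝ) ^ (k + 1) := by
      apply le_self_pow₀ _ (by omega)
      linarith
    have : (L : ℝ) < N := by nlinarith
    exact_mod_cast this
  set C := (Finset.range L).filter (fun j : ℕ => x + q * j ∈ A) with hC
  clear_value C
  set A' : Finset ℤ := C.map Nat.castEmbedding with hA'
  clear_value A'
  have hA'c : A'.card = C.card := by rw [hA']; exact Finset.card_map _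
  have hdpos : 0 < a * (1 + c * t) * L := by positivity
  have hCpos : (0 : ℝ) < C.card := lt_of_lt_of_le hdpos hdens
  have hres := ih L hLN A' (by
      intro y hy
      simp only [hA', hC, Finset.mem_map, Finset.mem_filter, Finset.mem_range,
        Nat.castEmbedding_apply] at hy
      obtain ⟨j, ⟨hj, _⟩, rfl⟩ := hy
      rw [Finset.mem_Ico]; omega) (by
      rw [← Finset.card_pos, hA'c]; exact_mod_cast hCpos) (by
      intro u hu v hv w hw huvw
      simp only [hA', hC, Finset.mem_map, Finset.mem_filter, Finset.mem_range,
        Nat.castEmbedding_apply] at hu hv hw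
      obtain ⟨i, ⟨_, hi⟩, rfl⟩ := hu
      obtain ⟨j, ⟨_, hj⟩, rfl⟩ := hv
      obtain ⟨l, ⟨_, hl⟩, rfl⟩ := hw
      have := hF _ hi _ hj _ hl (by linear_combination (q : ℤ) * huvw)
      have h2 : (q : ℤ) * i = q * l := by linarith
      exact mul_left_cancel₀ (by exact_mod_cast hq.ne') h2)
  rw [hA'c] at hres
  have hLC : (L : ℝ) / C.card ≤ a⁻¹ * (1 + c * t)⁻¹ := by
    rw [div_le_iff₀ hCpos]
    calc (L : ℝ) = a⁻¹ * (1 + c * t)⁻¹ * (a * (1 + c * t) * L) := by field_simp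
      _ ≤ _ := by gcongr
  have hlogL : Real.log N / (4 * (k + 1)) ≤ Real.log L := by
    rw [Real.le_log_iff_exp_le (by exact_mod_cast hLpos), ← hY]; exact hL2
  have h1 : Real.log N / (4 * (k + 1)) ≤ K * (a⁻¹ * (1 + c * t)⁻¹) ^ D := by
    refine hlogL.trans (hres.trans ?_)
    exact mul_le_mul_of_nonneg_left
      (pow_le_pow_left₀ (div_nonneg (Nat.cast_nonneg _) hCpos.le) hLC D) hK0.le
  rw [div_le_iff₀ (by positivity), mul_pow] at h1
  refine h1.trans ?_
  have h2 := hD k hk1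
  rw [← ht] at h2
  have h3 : (1 + c * t)⁻¹ ^ D * (4 * (k + 1)) ≤ 1 := by
    rw [inv_pow, ← div_eq_inv_mul, div_le_one (by positivity)]
    exact h2
  calc K * (a⁻¹ ^ D * (1 + c * t)⁻¹ ^ D) * (4 * (k + 1)) =
      K * a⁻¹ ^ D * ((1 + c * t)⁻¹ ^ D * (4 * (k + 1))) := by ring
    _ ≤ K * a⁻¹ ^ D * 1 := by gcongr
    _ = _ := by ring

end HB

/-- Heath-Brown: there are an absolute constant `c > 0` and an integer `M₀` such that
every subset `S ⊆ {0,…,M}` with `#S ≥ M/(log M)^c`, for `M > M₀`, contains a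
nontrivial three-term arithmetic progression `{m, m+m', m+2m'}`. -/
theorem stmt14 :
    ∃ c : ℝ, 0 < c ∧ ∃ M₀ : ℕ,
      ∀ M : ℕ, M₀ < M →
        ∀ S : Finset ℕ, (∀ s ∈ S, s ≤ M) →
          (M : ℝ) / (Real.log M) ^ c ≤ S.card →
          ∃ m m' : ℕ, 1 ≤ m' ∧ m ∈ S ∧ m + m' ∈ S ∧ m + 2 * m' ∈ S := by
  obtain ⟨K, D, hK, hD6, hmain⟩ := HB.main_bound
  have hD0 : (0 : ℝ) < D := by exact_mod_cast (by omega : 0 < D)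
  refine ⟨1 / (2 * D), by positivity, ⌈Real.exp ((K * 2 ^ D) ^ 2 + 1)⌉₊, ?_⟩
  intro M hM S hS hcard
  by_contra hcon
  push Not at hcon
  have hMexp : Real.exp ((K * 2 ^ D) ^ 2 + 1) < M := Nat.lt_of_ceil_lt hM
  have hM0 : (0 : ℝ) < M := (Real.exp_pos _).trans hMexp
  have hM1 : (1 : ℝ) ≤ M := by
    have : 0 < M := by exact_mod_cast hM0
    exact_mod_cast this
  have hlog : (K * 2 ^ D) ^ 2 + 1 < Real.log M := (Real.lt_log_iff_exp_lt hM0).2 hMexp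
  set l := Real.log M with hl
  have hl0 : 0 < l := lt_of_le_of_lt (by positivity) hlog
  set u := l ^ (1 / (2 * D) : ℝ) with hu
  have hu0 : 0 < u := by positivity
  have huD : u ^ D = Real.sqrt l := by
    rw [hu, ← Real.rpow_natCast, ← Real.rpow_mul hl0.le, Real.sqrt_eq_rpow]
    congr 1
    field_simp
  have hSpos : (0 : ℝ) < S.card := lt_of_lt_of_le (by positivity) hcard
  have hres := hmain (M + 1) (S.map Nat.castEmbedding) (by
      intro y hy
      simp only [Finset.mem_map, Nat.castEmbedding_apply] at hy
      obtain ⟨j, hj, rfl⟩ := hy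
      have := hS j hj
      rw [Finset.mem_Ico]; push_cast; omega) (by
      rw [← Finset.card_pos, Finset.card_map]; exact_mod_cast hSpos) (by
      intro a ha b hb d hd habd
      simp only [Finset.mem_map, Nat.castEmbedding_apply] at ha hb hd
      obtain ⟨i, hi, rfl⟩ := ha
      obtain ⟨j, hj, rfl⟩ := hb
      obtain ⟨k, hk, rfl⟩ := hd
      rcases lt_trichotomy i j with h | h | h
      · exfalso
        refine hcon i (j - i) (by omega) hi ?_ ?_
        · rwa [show i + (j - i) = j by omega]
        · rwa [show i + 2 * (j - i) = k by omega]
      · omega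
      · exfalso
        refine hcon k (j - k) (by omega) hk ?_ ?_
        · rwa [show k + (j - k) = j by omega]
        · rwa [show k + 2 * (j - k) = i by omega])
  rw [Finset.card_map] at hres
  have h1 : ((M + 1 : ℕ) : ℝ) / S.card ≤ 2 * u := by
    rw [div_le_iff₀ hSpos]
    rw [div_le_iff₀ hu0] at hcard
    push_cast
    linarith
  have h2 : l ≤ K * (2 * u) ^ D := by
    refine le_trans ?_ (hres.trans ?_)
    · rw [hl]
      apply Real.log_le_log hM0
      push_cast; linarith
    · gcongr
  rw [mul_pow, huD] at h2
  have hs := Real.sq_sqrt hl0.le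
  have hs0 : 0 < Real.sqrt l := Real.sqrt_pos.2 hl0
  have h3 : Real.sqrt l ≤ K * 2 ^ D := by
    have : Real.sqrt l * Real.sqrt l ≤ (K * 2 ^ D) * Real.sqrt l := by nlinarith
    exact le_of_mul_le_mul_right this hs0
  have h4 : Real.sqrt l ^ 2 ≤ (K * 2 ^ D) ^ 2 := by gcongr
  linarith
end
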